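/- Classification of singular vectors of degree 2: Let F be an irreducible finite-dimensional g_0-module with highest weight μ. A vector in Ind(F) is a nontrivial highest weight singular vector of degree 2 if and only if, up to scalar, it is one of: (a) μ=(0,n,1−n/2,−1−n/2) with n∈ℤ_{≥0} and vector w_{11}w_{21}⊗y_1^n; (b) μ=(m,0,1−m/2,1+m/2) with m∈ℤ_{≥0} and vector w_{11}w_{12}⊗x_1^m; (c) μ=(m,0,2+m/2,−m/2) with m∈ℤ_{>1} and vector w_{22}w_{21}⊗x_1^m + (w_{11}w_{22}+w_{21}w_{12})⊗x_1^{m−1}x_2 − w_{11}w_{12}⊗x_1^{m−2}x_2^2; (d) μ=(0,n,2+n/2,n/2) with n∈ℤ_{>1} and vector w_{22}w_{12}⊗y_1^n − (w_{22}w_{11}+w_{21}w_{12})⊗y_1^{n−1}y_2 − w_{11}w_{21}⊗y_1^{n−2}y_2^2. -/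

import Mathlib

/-!
Core definitions modelling the annihilation superalgebra `𝔤 = 𝒜(K'₄) = K(1,4)₊ ⊕ ℂC`
and generalized Verma modules `Ind F ≅ ℂ[Θ] ⊗ Λ(η₁,…,η₄) ⊗ F` over it.

Grassmann monomials `ξ_I`/`η_I` (with `I` in increasing order) are indexed by
`Idx = Finset (Fin 4)`.
-/

open Finset

noncomputable section

/-- Index set of a Grassmann monomial in `ξ₁,…,ξ₄` (0-indexed). -/
abbrev Idx : Type := Finset (Fin 4)

/-- Sign appearing when multiplying two Grassmann monomials: `ξ_I ξ_J = msign I J • ξ_{I ∪ J}`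
(for `I, J` disjoint). -/
def msign (I J : Idx) : ℤ := (-1 : ℤ) ^ ((I ×ˢ J).filter (fun p => p.2 < p.1)).card

/-- Sign of `∂ᵢ ξ_I` (for `i ∈ I`): `∂ᵢ ξ_I = dsign i I • ξ_{I \ {i}}`. -/
def dsign (i : Fin 4) (I : Idx) : ℤ := (-1 : ℤ) ^ (I.filter (fun j => j < i)).card

/-- Sign of the iterated derivative `∂_S η_L = ∂_{s₁} ⋯ ∂_{s_k} η_L` (`s₁ < ⋯ < s_k`,
`S ⊆ L`): `∂_S η_L = ddsign S L • η_{L \ S}`. -/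
def ddsign (S L : Idx) : ℤ :=
  (-1 : ℤ) ^ (S.card * (S.card - 1) / 2) *
    (-1 : ℤ) ^ (∑ i ∈ S, ((L \ S).filter (fun j => j < i)).card)

/-- `epsSign I` is the sign `ε_I` of the permutation `(I, Iᶜ)` of `(1,2,3,4)`. -/
def epsSign (I : Idx) : ℤ := msign I Iᶜ

variable (F : Type*) [AddCommGroup F] [Module ℂ F]

/-- The generalized Verma module `Ind F = ℂ[Θ] ⊗ Λ(η₁,…,η₄) ⊗ F`,
with `(k, L)`-component the coefficient of `Θ^k η_L`. -/
abbrev VInd : Type _ := (ℕ × Idx) →₀ F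

variable {F}

/-- Basis-type element `Θ^k η_L ⊗ v` of `Ind F`. -/
def bv (k : ℕ) (L : Idx) (v : F) : VInd F := Finsupp.single (k, L) v

/-- Action of the central element `C` on `Ind F`: it acts through its action `ρC` on `F`. -/
def Cop (ρC : F →ₗ[ℂ] F) : VInd F →ₗ[ℂ] VInd F := Finsupp.mapRange.linearMap ρC

/-- Multiplication by `Θ` on `Ind F`. -/
def thOp : VInd F →ₗ[ℂ] VInd F := Finsupp.lmapDomain F ℂ (fun p => (p.1 + 1, p.2))

/-- The 2-cocycle `ψ` on `K(1,4)₊` defining the central extension `𝒜(K'₄)`, evaluated on the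
basis monomials `t^0 ξ_I`, `t^0 ξ_J`: the only nonzero values are
`ψ(1, ξ₁₂₃₄) = -2`, `ψ(ξ₁₂₃₄, 1) = 2` and `ψ(ξ_i, ξ_{{i}ᶜ}) = ψ(ξ_{{i}ᶜ}, ξ_i) = -∂ᵢ-sign`
(equivalently `ψ(ξ_i, ∂ᵢξ₁₂₃₄) = -1`). -/
def psi0 (I J : Idx) : ℂ :=
  (if I = (∅ : Idx) ∧ J = (Finset.univ : Idx) then (-2 : ℂ) else 0)
  + (if I = (Finset.univ : Idx) ∧ J = (∅ : Idx) then (2 : ℂ) else 0)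
  + ∑ i : Fin 4, (if I = ({i} : Idx) ∧ J = ({i}ᶜ : Idx) then (-(dsign i Finset.univ) : ℂ) else 0)
  + ∑ i : Fin 4, (if I = ({i}ᶜ : Idx) ∧ J = ({i} : Idx) then (-(dsign i Finset.univ) : ℂ) else 0)

/-- The action on `Ind F` of the bracket `[t^m ξ_I, t^n ξ_J]` in `𝒜(K'₄) = K(1,4)₊ ⊕ ℂC`,
namely of
`(2n-2m-n|I|+m|J|) t^{m+n-1} ξ_{IJ} + (-1)^{|I|} t^{m+n} ∑ᵢ ∂ᵢξ_I ∂ᵢξ_J + ψ(t^mξ_I, t^nξ_J) C`,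
expressed through a family `act` of operators (the actions of the `t^m ξ_I`). -/
def brkAct (ρC : F →ₗ[ℂ] F) (act : ℕ → Idx → (VInd F →ₗ[ℂ] VInd F))
    (m : ℕ) (I : Idx) (n : ℕ) (J : Idx) : VInd F →ₗ[ℂ] VInd F :=
  ((2 * (n : ℤ) - 2 * (m : ℤ) - (n : ℤ) * I.card + (m : ℤ) * J.card : ℤ) : ℂ) •
      (if Disjoint I J then ((msign I J : ℤ) : ℂ) • act (m + n - 1) (I ∪ J) else 0)
  + ((-1 : ℂ) ^ I.card) • (∑ i : Fin 4,
      if i ∈ I ∧ i ∈ J ∧ Disjoint (I.erase i) (J.erase i) then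
        ((dsign i I * dsign i J * msign (I.erase i) (J.erase i) : ℤ) : ℂ) •
          act (m + n) (I.erase i ∪ J.erase i)
      else 0)
  + (if m = 0 ∧ n = 0 then psi0 I J else 0) • Cop ρC

/-- The data of a generalized Verma module over `𝒜(K'₄)`:
the action `ρt, ρC, ρξ i j` of the degree-zero part `𝔤₀ = ⟨C, t, ξ_{ij}⟩` on `F`,
and the action `act m I` of the basis elements `t^m ξ_I` of `K(1,4)₊` on
`Ind F = ℂ[Θ] ⊗ Λ(η) ⊗ F`. -/
structure VermaData (F : Type*) [AddCommGroup F] [Module ℂ F] where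
  ρt : F →ₗ[ℂ] F
  ρC : F →ₗ[ℂ] F
  ρξ : Fin 4 → Fin 4 → (F →ₗ[ℂ] F)
  act : ℕ → Idx → (VInd F →ₗ[ℂ] VInd F)

/-- The properties characterizing the generalized Verma module `Ind F` over `𝒜(K'₄)`:
* `anti` : `ξ_{ij} = -ξ_{ji}`;
* `lie`  : `act` is an action of the Lie superalgebra `𝒜(K'₄) = K(1,4)₊ ⊕ ℂC`
  (with `C` acting through `ρC`);
* `vac_pos` : the positive part `𝔤_{>0}` (spanned by the `t^m ξ_I` with `2m + |I| - 2 > 0`)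
  kills the vacuum subspace `1 ⊗ F`;
* `vac_xi`, `vac_t` : `𝔤₀` acts on `1 ⊗ F` through `ρξ`, `ρt`;
* `low_eta`, `low_one` : the negative part acts by left multiplication in
  `U(𝔤_{<0}) = ℂ[Θ] ⊗ Λ(η₁,…,η₄)` (with `η_i² = Θ` and `ξ_∅ = -2Θ`). -/
structure IsVerma (D : VermaData F) : Prop where
  anti : ∀ i j, D.ρξ i j = - D.ρξ j i
  lie : ∀ (m : ℕ) (I : Idx) (n : ℕ) (J : Idx),
      D.act m I ∘ₗ D.act n J - ((-1 : ℂ) ^ (I.card * J.card)) • (D.act n J ∘ₗ D.act m I)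
        = brkAct D.ρC D.act m I n J
  vac_pos : ∀ (v : F) (m : ℕ) (I : Idx), 2 < 2 * m + I.card → D.act m I (bv 0 ∅ v) = 0
  vac_xi : ∀ (v : F) (i j : Fin 4), i < j →
      D.act 0 {i, j} (bv 0 ∅ v) = bv 0 ∅ (D.ρξ i j v)
  vac_t : ∀ v : F, D.act 1 ∅ (bv 0 ∅ v) = bv 0 ∅ (D.ρt v)
  low_eta : ∀ (v : F) (k : ℕ) (L : Idx) (i : Fin 4),
      D.act 0 {i} (bv k L v) =
        if i ∈ L then ((dsign i L : ℤ) : ℂ) • bv (k + 1) (L.erase i) v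
        else ((msign {i} L : ℤ) : ℂ) • bv k (insert i L) v
  low_one : ∀ (v : F) (k : ℕ) (L : Idx),
      D.act 0 ∅ (bv k L v) = (-2 : ℂ) • bv (k + 1) L v

/-- A (nonzero) singular vector: a nonzero vector killed by
`𝔤_{>0} = ⟨t^m ξ_I : 2m + |I| - 2 > 0⟩`. -/
def IsSingular (D : VermaData F) (u : VInd F) : Prop :=
  u ≠ 0 ∧ ∀ (m : ℕ) (I : Idx), 2 < 2 * m + I.card → D.act m I u = 0

/-- `u` is homogeneous of degree `d` (`Θ^k η_L ⊗ v` has degree `2k + |L|`). -/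
def HomogDeg (u : VInd F) (d : ℕ) : Prop := ∀ p ∈ u.support, 2 * p.1 + p.2.card = d

/-- `u` is a highest weight vector: it is killed by the positive root vectors
`e₁ = -ξ₁₃ + i ξ₂₃` and `e₂ = -ξ₂₄ - i ξ₁₄` of `𝔤₀` (0-indexed below). -/
def IsHW (D : VermaData F) (u : VInd F) : Prop :=
  Complex.I • D.act 0 {1, 2} u - D.act 0 {0, 2} u = 0 ∧
  -(D.act 0 {1, 3} u) - Complex.I • D.act 0 {0, 3} u = 0

/-- `e₁ = e_x + e_y = -ξ₁₃ + i ξ₂₃` acting on `F`. -/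
def e1F (D : VermaData F) : F →ₗ[ℂ] F := -(D.ρξ 0 2) + Complex.I • D.ρξ 1 2

/-- `e₂ = e_x - e_y = -ξ₂₄ - i ξ₁₄` acting on `F`. -/
def e2F (D : VermaData F) : F →ₗ[ℂ] F := -(D.ρξ 1 3) - Complex.I • D.ρξ 0 3

/-- `h_x = -iξ₁₂ + iξ₃₄` acting on `F`. -/
def hxF (D : VermaData F) : F →ₗ[ℂ] F := -(Complex.I • D.ρξ 0 1) + Complex.I • D.ρξ 2 3

/-- `h_y = -iξ₁₂ - iξ₃₄` acting on `F`. -/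
def hyF (D : VermaData F) : F →ₗ[ℂ] F := -(Complex.I • D.ρξ 0 1) - Complex.I • D.ρξ 2 3

/-- `f_x = (ξ₁₃ + ξ₂₄ - iξ₁₄ + iξ₂₃)/2` acting on `F`. -/
def fxF (D : VermaData F) : F →ₗ[ℂ] F :=
  (2 : ℂ)⁻¹ • (D.ρξ 0 2 + D.ρξ 1 3 - Complex.I • D.ρξ 0 3 + Complex.I • D.ρξ 1 2)

/-- `f_y = (ξ₁₃ - ξ₂₄ + iξ₁₄ + iξ₂₃)/2` acting on `F`. -/
def fyF (D : VermaData F) : F →ₗ[ℂ] F :=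
  (2 : ℂ)⁻¹ • (D.ρξ 0 2 - D.ρξ 1 3 + Complex.I • D.ρξ 0 3 + Complex.I • D.ρξ 1 2)

/-- `v` is a highest weight vector of `F` of weight `μ = (μ.1, μ.2.1, μ.2.2.1, μ.2.2.2)`
with respect to `(h_x, h_y, t, C)`. -/
def IsHWvec (D : VermaData F) (μ : ℂ × ℂ × ℂ × ℂ) (v : F) : Prop :=
  v ≠ 0 ∧ e1F D v = 0 ∧ e2F D v = 0 ∧ hxF D v = μ.1 • v ∧ hyF D v = μ.2.1 • v ∧
    D.ρt v = μ.2.2.1 • v ∧ D.ρC v = μ.2.2.2 • v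

/-- `F` is an irreducible `𝔤₀`-module. -/
def IsIrred (D : VermaData F) : Prop :=
  (∃ v : F, v ≠ 0) ∧ ∀ p : Submodule ℂ F,
    (∀ v ∈ p, D.ρt v ∈ p ∧ D.ρC v ∈ p ∧ ∀ i j, D.ρξ i j v ∈ p) → p = ⊥ ∨ p = ⊤

/-- The commutative-in-`Θ` algebra `U(𝔤_{<0}) = ℂ[Θ] ⊗ Λ(η₁,…,η₄)` (as a ℂ-module with
basis `Θ^k η_L`). -/
abbrev CA : Type := (ℕ × Idx) →₀ ℂ

/-- Multiplication in `U(𝔤_{<0})` (`η_i² = Θ`, `Θ` central, `η_i η_j = -η_j η_i`). -/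
def cmul (x y : CA) : CA :=
  x.sum fun p c => y.sum fun q c' =>
    Finsupp.single (p.1 + q.1 + (p.2 ∩ q.2).card, (p.2 \ q.2) ∪ (q.2 \ p.2))
      (c * c' * ((msign p.2 q.2 : ℤ) : ℂ))

/-- `w₁₁ = η₂ + i η₁`. -/
def w11 : CA := Finsupp.single (0, ({1} : Idx)) 1 + Complex.I • Finsupp.single (0, ({0} : Idx)) 1
/-- `w₂₂ = η₂ - i η₁`. -/
def w22 : CA := Finsupp.single (0, ({1} : Idx)) 1 - Complex.I • Finsupp.single (0, ({0} : Idx)) 1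
/-- `w₁₂ = -η₄ + i η₃`. -/
def w12 : CA := -Finsupp.single (0, ({3} : Idx)) 1 + Complex.I • Finsupp.single (0, ({2} : Idx)) 1
/-- `w₂₁ = η₄ + i η₃`. -/
def w21 : CA := Finsupp.single (0, ({3} : Idx)) 1 + Complex.I • Finsupp.single (0, ({2} : Idx)) 1

/-- `a ⊗ v ∈ U(𝔤_{<0}) ⊗ F = Ind F`. -/
def tens (a : CA) (v : F) : VInd F := a.sum fun p c => Finsupp.single p (c • v)

end

namespace Sing2

section Rep

variable {F : Type*} [AddCommGroup F] [Module ℂ F]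

/-- Two commuting `sl₂`-triples acting jointly irreducibly on `F`. -/
structure Sl2Pair (ex fx hx ey fy hy : Module.End ℂ F) : Prop where
  xef : ∀ v, ex (fx v) = fx (ex v) + hx v
  xhe : ∀ v, hx (ex v) = ex (hx v) + (2 : ℂ) • ex v
  xhf : ∀ v, hx (fx v) = fx (hx v) - (2 : ℂ) • fx v
  yef : ∀ v, ey (fy v) = fy (ey v) + hy v
  yhe : ∀ v, hy (ey v) = ey (hy v) + (2 : ℂ) • ey v
  yhf : ∀ v, hy (fy v) = fy (hy v) - (2 : ℂ) • fy v
  cee : ∀ v, ex (ey v) = ey (ex v)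
  cef : ∀ v, ex (fy v) = fy (ex v)
  cfe : ∀ v, fx (ey v) = ey (fx v)
  cff : ∀ v, fx (fy v) = fy (fx v)
  irr : ∀ p : Submodule ℂ F,
    (∀ v ∈ p, ex v ∈ p ∧ fx v ∈ p ∧ ey v ∈ p ∧ fy v ∈ p) → p = ⊥ ∨ p = ⊤

variable {ex fx hx ey fy hy : Module.End ℂ F}

namespace Sl2Pair

theorem swap (P : Sl2Pair ex fx hx ey fy hy) : Sl2Pair ey fy hy ex fx hx where
  xef := P.yef
  xhe := P.yhe
  xhf := P.yhf
  yef := P.xef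
  yhe := P.xhe
  yhf := P.xhf
  cee v := (P.cee v).symm
  cef v := (P.cfe v).symm
  cfe v := (P.cef v).symm
  cff v := (P.cff v).symm
  irr p hp := P.irr p fun v hv =>
    ⟨(hp v hv).2.2.1, (hp v hv).2.2.2, (hp v hv).1, (hp v hv).2.1⟩

theorem hx_fy (P : Sl2Pair ex fx hx ey fy hy) (v : F) : hx (fy v) = fy (hx v) := by
  have h1 := P.xef (fy v)
  rw [P.cff, P.cef, P.cef, P.cff, P.xef, map_add] at h1
  exact (add_left_cancel h1).symm

theorem hx_ey (P : Sl2Pair ex fx hx ey fy hy) (v : F) : hx (ey v) = ey (hx v) := by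
  have h1 := P.xef (ey v)
  rw [P.cfe, P.cee, P.cee, P.cfe, P.xef, map_add] at h1
  exact (add_left_cancel h1).symm

theorem hx_hy (P : Sl2Pair ex fx hx ey fy hy) (v : F) : hx (hy v) = hy (hx v) := by
  have h1 := congrArg hx (P.yef v)
  rw [map_add, P.hx_ey, P.hx_fy, P.hx_fy, P.hx_ey, P.yef] at h1
  exact (add_left_cancel h1).symm

theorem hx_pow (P : Sl2Pair ex fx hx ey fy hy) (i : ℕ) (s : F) :
    hx ((fx ^ i) s) = (fx ^ i) (hx s - (2 * i : ℂ) • s) := by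
  induction i with
  | zero => simp
  | succ i ih =>
    rw [pow_succ', Module.End.mul_apply, P.xhf, ih, Module.End.mul_apply, ← map_smul, ← map_sub,
      ← map_smul, ← map_sub]
    congr 2
    push_cast
    module

theorem ex_pow (P : Sl2Pair ex fx hx ey fy hy) (i : ℕ) (s : F) (hs : ex s = 0) :
    ex ((fx ^ (i + 1)) s) = (fx ^ i) ((i + 1 : ℂ) • (hx s - (i : ℂ) • s)) := by
  induction i with
  | zero => simp [P.xef, hs]
  | succ i ih =>
    rw [pow_succ', Module.End.mul_apply, P.xef, ih, P.hx_pow, pow_succ', Module.End.mul_apply,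
      Module.End.mul_apply, ← map_add, ← map_add]
    congr 2
    push_cast
    module

theorem pow_comm (P : Sl2Pair ex fx hx ey fy hy) (i j : ℕ) (s : F) :
    (fx ^ i) ((fy ^ j) s) = (fy ^ j) ((fx ^ i) s) := by
  have h : Commute fx fy := LinearMap.ext P.cff
  exact LinearMap.congr_fun (h.pow_pow i j) s

theorem ex_fypow (P : Sl2Pair ex fx hx ey fy hy) (j : ℕ) (s : F) :
    ex ((fy ^ j) s) = (fy ^ j) (ex s) := by
  have h : Commute ex fy := LinearMap.ext P.cef
  exact LinearMap.congr_fun (h.pow_right j) s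

theorem hx_fypow (P : Sl2Pair ex fx hx ey fy hy) (j : ℕ) (s : F) :
    hx ((fy ^ j) s) = (fy ^ j) (hx s) := by
  have h : Commute hx fy := LinearMap.ext P.hx_fy
  exact LinearMap.congr_fun (h.pow_right j) s

/-- The span of all `f_x^i f_y^j s`, `s ∈ S`. -/
def nspan (fx fy : Module.End ℂ F) (S : Submodule ℂ F) : Submodule ℂ F :=
  Submodule.span ℂ {w | ∃ i j : ℕ, ∃ s ∈ S, w = (fx ^ i) ((fy ^ j) s)}

theorem mem_nspan {S : Submodule ℂ F} (i j : ℕ) {s : F} (hs : s ∈ S) :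
    (fx ^ i) ((fy ^ j) s) ∈ nspan fx fy S := Submodule.subset_span ⟨i, j, s, hs, rfl⟩

theorem nspan_swap (P : Sl2Pair ex fx hx ey fy hy) (S : Submodule ℂ F) :
    nspan fx fy S = nspan fy fx S := by
  unfold nspan
  congr 1
  ext w
  constructor
  · rintro ⟨i, j, s, hs, rfl⟩
    exact ⟨j, i, s, hs, P.pow_comm i j s⟩
  · rintro ⟨i, j, s, hs, rfl⟩
    exact ⟨j, i, s, hs, (P.pow_comm j i s).symm⟩

theorem nspan_fx (S : Submodule ℂ F) : ∀ v ∈ nspan fx fy S, fx v ∈ nspan fx fy S := by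
  intro v hv
  have : nspan fx fy S ≤ (nspan fx fy S).comap fx := by
    refine Submodule.span_le.2 ?_
    rintro _ ⟨i, j, s, hs, rfl⟩
    have := mem_nspan (fx := fx) (fy := fy) (i + 1) j hs
    rw [pow_succ', Module.End.mul_apply] at this
    exact this
  exact this hv

theorem nspan_ex (P : Sl2Pair ex fx hx ey fy hy) (S : Submodule ℂ F)
    (he : ∀ s ∈ S, ex s = 0) (hh : ∀ s ∈ S, hx s ∈ S) :
    ∀ v ∈ nspan fx fy S, ex v ∈ nspan fx fy S := by
  intro v hv
  have : nspan fx fy S ≤ (nspan fx fy S).comap ex := by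
    refine Submodule.span_le.2 ?_
    rintro _ ⟨i, j, s, hs, rfl⟩
    have h0 : ex ((fy ^ j) s) = 0 := by rw [P.ex_fypow, he s hs, map_zero]
    change ex ((fx ^ i) ((fy ^ j) s)) ∈ nspan fx fy S
    cases i with
    | zero => simp [h0]
    | succ i =>
      rw [P.ex_pow i _ h0, P.hx_fypow, ← map_smul, ← map_sub, ← map_smul]
      exact mem_nspan i j (S.smul_mem _ (S.sub_mem (hh s hs) (S.smul_mem _ hs)))
  exact this hv

theorem nspan_irr (P : Sl2Pair ex fx hx ey fy hy) (S : Submodule ℂ F)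
    (hex : ∀ s ∈ S, ex s = 0) (hhx : ∀ s ∈ S, hx s ∈ S)
    (hey : ∀ s ∈ S, ey s = 0) (hhy : ∀ s ∈ S, hy s ∈ S) :
    nspan fx fy S = ⊥ ∨ nspan fx fy S = ⊤ := by
  refine P.irr _ fun v hv => ⟨P.nspan_ex S hex hhx v hv, nspan_fx S v hv, ?_, ?_⟩
  · rw [P.nspan_swap] at hv ⊢
    exact P.swap.nspan_ex S hey hhy v hv
  · rw [P.nspan_swap] at hv ⊢
    exact nspan_fx S v hv

/-- Data of a highest weight vector. -/
structure HW (ex hx ey hy : Module.End ℂ F) (a b : ℂ) (v : F) : Prop where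
  ne : v ≠ 0
  ex0 : ex v = 0
  ey0 : ey v = 0
  hxv : hx v = a • v
  hyv : hy v = b • v

variable {a b : ℂ} {v : F}

theorem nspan_top (P : Sl2Pair ex fx hx ey fy hy) (h : HW ex hx ey hy a b v) :
    nspan fx fy (Submodule.span ℂ {v}) = ⊤ := by
  have key := P.nspan_irr (Submodule.span ℂ {v}) ?_ ?_ ?_ ?_
  · refine key.resolve_left fun hb => h.ne ?_
    have := mem_nspan (fx := fx) (fy := fy) 0 0 (Submodule.mem_span_singleton_self (R := ℂ) v)
    rw [hb] at this
    simpa using this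
  all_goals
    intro s hs
    obtain ⟨c, rfl⟩ := Submodule.mem_span_singleton.1 hs
    simp only [map_smul, h.ex0, h.ey0, h.hxv, h.hyv, smul_zero]
  all_goals
    exact Submodule.smul_mem _ _ (Submodule.smul_mem _ _ (Submodule.mem_span_singleton_self v))

/-- The sum of the eigenspaces of `h_x + h_y` strictly below the top one. -/
def lower (hx hy : Module.End ℂ F) (l : ℂ) : Submodule ℂ F :=
  ⨆ k : ℕ, Module.End.eigenspace (hx + hy) (l - 2 * (k + 1))

theorem lower_not_mem {l : ℂ} {w : F} (hw : (hx + hy) w = l • w) (hl : w ∈ lower hx hy l) :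
    w = 0 := by
  have h1 := Module.End.eigenspaces_iSupIndep (hx + hy) l
  have h2 : lower hx hy l ≤ ⨆ μ, ⨆ (_ : μ ≠ l), Module.End.eigenspace (hx + hy) μ := by
    refine iSup_le fun k => le_iSup₂_of_le (l - 2 * (k + 1)) ?_ le_rfl
    intro hk
    have : ((k : ℂ) + 1) = 0 := by linear_combination (-1 / 2 : ℂ) * hk
    exact Nat.cast_add_one_ne_zero k this
  exact Submodule.disjoint_def.1 h1 w (Module.End.mem_eigenspace_iff.2 hw) (h2 hl)

theorem lower_hx (P : Sl2Pair ex fx hx ey fy hy) (l : ℂ) :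
    ∀ w ∈ lower hx hy l, hx w ∈ lower hx hy l := by
  intro w hw
  have : lower hx hy l ≤ (lower hx hy l).comap hx := by
    refine iSup_le fun k x hx' => Submodule.mem_iSup_of_mem k ?_
    rw [Module.End.mem_eigenspace_iff] at hx' ⊢
    rw [LinearMap.add_apply, ← P.hx_hy, ← map_add, ← LinearMap.add_apply, hx', map_smul]
  exact this hw

theorem fx_eig (P : Sl2Pair ex fx hx ey fy hy) (l : ℂ) (w : F) (hw : (hx + hy) w = l • w) :
    (hx + hy) (fx w) = (l - 2) • fx w := by
  rw [LinearMap.add_apply] at hw ⊢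
  rw [P.xhf, P.swap.hx_fy, sub_add_eq_add_sub, ← map_add, hw, map_smul]
  module

theorem lower_fx (P : Sl2Pair ex fx hx ey fy hy) (l : ℂ) :
    ∀ w ∈ lower hx hy l, fx w ∈ lower hx hy l := by
  intro w hw
  have : lower hx hy l ≤ (lower hx hy l).comap fx := by
    refine iSup_le fun k x hx' => Submodule.mem_iSup_of_mem (k + 1) ?_
    rw [Module.End.mem_eigenspace_iff] at hx' ⊢
    rw [P.fx_eig _ _ hx']
    congr 1
    push_cast
    ring
  exact this hw

theorem lower_swap (l : ℂ) : lower hx hy l = lower hy hx l := by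
  unfold lower
  rw [add_comm]

theorem lower_hy (P : Sl2Pair ex fx hx ey fy hy) (l : ℂ) :
    ∀ w ∈ lower hx hy l, hy w ∈ lower hx hy l := by
  rw [lower_swap]
  exact P.swap.lower_hx l

theorem lower_fy (P : Sl2Pair ex fx hx ey fy hy) (l : ℂ) :
    ∀ w ∈ lower hx hy l, fy w ∈ lower hx hy l := by
  rw [lower_swap]
  exact P.swap.lower_fx l

theorem lower_fxpow (P : Sl2Pair ex fx hx ey fy hy) (l : ℂ) (i : ℕ) :
    ∀ w ∈ lower hx hy l, (fx ^ i) w ∈ lower hx hy l := by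
  induction i with
  | zero => intro w hw; simpa using hw
  | succ i ih =>
    intro w hw
    rw [pow_succ', Module.End.mul_apply]
    exact P.lower_fx l _ (ih w hw)

theorem lower_fypow (P : Sl2Pair ex fx hx ey fy hy) (l : ℂ) (i : ℕ) :
    ∀ w ∈ lower hx hy l, (fy ^ i) w ∈ lower hx hy l := by
  rw [lower_swap]
  exact P.swap.lower_fxpow l i

theorem top_lower (P : Sl2Pair ex fx hx ey fy hy) (l : ℂ) (w : F) (hw : (hx + hy) w = l • w) :
    fx w ∈ lower hx hy l := by
  refine Submodule.mem_iSup_of_mem 0 ?_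
  rw [Module.End.mem_eigenspace_iff, P.fx_eig l w hw]
  norm_num

theorem span_sup_lower (P : Sl2Pair ex fx hx ey fy hy) (h : HW ex hx ey hy a b v) :
    Submodule.span ℂ {v} ⊔ lower hx hy (a + b) = ⊤ := by
  rw [eq_top_iff, ← P.nspan_top h]
  refine Submodule.span_le.2 ?_
  rintro _ ⟨i, j, s, hs, rfl⟩
  have hsl : (hx + hy) s = (a + b) • s := by
    obtain ⟨c, rfl⟩ := Submodule.mem_span_singleton.1 hs
    rw [LinearMap.add_apply, map_smul, map_smul, h.hxv, h.hyv]
    module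
  rcases i with _ | i
  · rcases j with _ | j
    · exact Submodule.mem_sup_left (by simpa using hs)
    · refine Submodule.mem_sup_right ?_
      rw [pow_succ, Module.End.mul_apply]
      refine P.lower_fxpow _ 0 _ (P.lower_fypow _ j _ ?_)
      rw [lower_swap]
      exact P.swap.top_lower _ _ (by rw [add_comm]; exact hsl)
  · refine Submodule.mem_sup_right ?_
    rw [P.pow_comm, pow_succ, Module.End.mul_apply]
    exact P.lower_fypow _ j _ (P.lower_fxpow _ i _ (P.top_lower _ _ hsl))

/-- Uniqueness of the highest weight vector. -/
theorem hw_unique (P : Sl2Pair ex fx hx ey fy hy) (h : HW ex hx ey hy a b v) (p : F)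
    (hxp : ex p = 0) (hyp : ey p = 0) : ∃ c : ℂ, p = c • v := by
  set S : Submodule ℂ F := LinearMap.ker ex ⊓ LinearMap.ker ey ⊓ lower hx hy (a + b) with hS
  have hSx : ∀ s ∈ S, ex s = 0 := fun s hs => hs.1.1
  have hSy : ∀ s ∈ S, ey s = 0 := fun s hs => hs.1.2
  have key := P.nspan_irr S hSx ?_ hSy ?_
  · have hle : nspan fx fy S ≤ lower hx hy (a + b) := by
      refine Submodule.span_le.2 ?_
      rintro _ ⟨i, j, s, hs, rfl⟩
      exact P.lower_fxpow _ _ _ (P.lower_fypow _ _ _ hs.2)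
    have hbot : nspan fx fy S = ⊥ := by
      refine key.resolve_right fun ht => h.ne ?_
      rw [ht] at hle
      refine lower_not_mem (hx := hx) (hy := hy) (l := a + b) ?_ (hle trivial)
      rw [LinearMap.add_apply, h.hxv, h.hyv, add_smul]
    have hp : p ∈ Submodule.span ℂ {v} ⊔ lower hx hy (a + b) := by
      rw [P.span_sup_lower h]; trivial
    obtain ⟨y, hy', z, hz, rfl⟩ := Submodule.mem_sup.1 hp
    obtain ⟨c, rfl⟩ := Submodule.mem_span_singleton.1 hy'
    rw [map_add, map_smul, h.ex0, smul_zero, zero_add] at hxp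
    rw [map_add, map_smul, h.ey0, smul_zero, zero_add] at hyp
    have hzS : z ∈ S := ⟨⟨hxp, hyp⟩, hz⟩
    have h0 := mem_nspan (fx := fx) (fy := fy) 0 0 hzS
    rw [hbot] at h0
    have : z = 0 := by simpa using h0
    exact ⟨c, by rw [this, add_zero]⟩
  · intro s hs
    refine ⟨⟨?_, ?_⟩, P.lower_hx _ _ hs.2⟩
    · have := P.xhe s
      rw [hSx s hs, map_zero, smul_zero, add_zero] at this
      exact this.symm
    · have := P.hx_ey s
      rw [hSy s hs, map_zero] at this
      exact this.symm
  · intro s hs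
    refine ⟨⟨?_, ?_⟩, P.lower_hy _ _ hs.2⟩
    · have := P.swap.hx_ey s
      rw [hSx s hs, map_zero] at this
      exact this.symm
    · have := P.yhe s
      rw [hSy s hs, map_zero, smul_zero, add_zero] at this
      exact this.symm

theorem fx_zero (P : Sl2Pair ex fx hx ey fy hy) (h : HW ex hx ey hy a b v) (ha : a = 0) :
    fx v = 0 := by
  by_contra hne
  obtain ⟨c, hc⟩ := P.hw_unique h (fx v) (by rw [P.xef, h.ex0, h.hxv, ha]; simp)
    (by rw [← P.cfe, h.ey0, map_zero])
  have h2 := P.xhf v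
  rw [h.hxv, ha, zero_smul, map_zero, zero_sub, hc, map_smul, h.hxv, ha, zero_smul, smul_zero,
    ← hc] at h2
  apply hne
  rw [eq_comm, neg_eq_zero, smul_eq_zero] at h2
  exact h2.resolve_left two_ne_zero

/-- The kernel of the first `sl₂`. -/
theorem ker_x (P : Sl2Pair ex fx hx ey fy hy) (h : HW ex hx ey hy a b v) (ha : a ≠ 0) (p : F)
    (h1 : ex p = 0) (h2 : fx p = 0) : p = 0 := by
  have key := P.irr (LinearMap.ker ex ⊓ LinearMap.ker fx) ?_
  · rcases key with hb | ht
    · have : p ∈ LinearMap.ker ex ⊓ LinearMap.ker fx := ⟨h1, h2⟩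
      rw [hb] at this
      simpa using this
    · exfalso
      have : v ∈ LinearMap.ker ex ⊓ LinearMap.ker fx := by rw [ht]; trivial
      have h3 : fx v = 0 := this.2
      have h4 := P.xef v
      rw [h3, h.ex0, h.hxv, map_zero, map_zero, zero_add, eq_comm, smul_eq_zero] at h4
      exact h4.elim ha h.ne
  · rintro w ⟨hw1, hw2⟩
    have e1 : ex w = 0 := hw1
    have e2 : fx w = 0 := hw2
    refine ⟨by rw [e1]; exact zero_mem _, by rw [e2]; exact zero_mem _, ⟨?_, ?_⟩, ⟨?_, ?_⟩⟩
    · change ex _ = 0; rw [P.cee, e1, map_zero]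
    · change fx _ = 0; rw [P.cfe, e2, map_zero]
    · change ex _ = 0; rw [P.cef, e1, map_zero]
    · change fx _ = 0; rw [P.cff, e2, map_zero]

theorem triv_x (P : Sl2Pair ex fx hx ey fy hy) (h : HW ex hx ey hy a b v) (ha : a = 0) (p : F) :
    ex p = 0 ∧ fx p = 0 := by
  have key := P.irr (LinearMap.ker ex ⊓ LinearMap.ker fx) ?_
  · rcases key with hb | ht
    · exfalso
      have : v ∈ LinearMap.ker ex ⊓ LinearMap.ker fx := ⟨h.ex0, P.fx_zero h ha⟩
      rw [hb] at this
      exact h.ne (by simpa using this)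
    · have : p ∈ LinearMap.ker ex ⊓ LinearMap.ker fx := by rw [ht]; trivial
      exact this
  · rintro w ⟨hw1, hw2⟩
    have e1 : ex w = 0 := hw1
    have e2 : fx w = 0 := hw2
    refine ⟨by rw [e1]; exact zero_mem _, by rw [e2]; exact zero_mem _, ⟨?_, ?_⟩, ⟨?_, ?_⟩⟩
    · change ex _ = 0; rw [P.cee, e1, map_zero]
    · change fx _ = 0; rw [P.cfe, e2, map_zero]
    · change ex _ = 0; rw [P.cef, e1, map_zero]
    · change fx _ = 0; rw [P.cff, e2, map_zero]

theorem triv_hx (P : Sl2Pair ex fx hx ey fy hy) (h : HW ex hx ey hy a b v) (ha : a = 0) (p : F) :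
    hx p = 0 := by
  have := P.xef p
  rw [(P.triv_x h ha p).2, (P.triv_x h ha p).1, map_zero, map_zero, zero_add] at this
  exact this.symm

theorem exists_nat (P : Sl2Pair ex fx hx ey fy hy) [FiniteDimensional ℂ F]
    (h : HW ex hx ey hy a b v) : ∃ n : ℕ, a = n := by
  by_cases hne : hx = 0
  · refine ⟨0, ?_⟩
    have := h.hxv
    rw [hne, LinearMap.zero_apply, eq_comm, smul_eq_zero] at this
    simpa using this.resolve_right h.ne
  let _ : LieRing (Module.End ℂ F) := LieRing.ofAssociativeRing
  have t : IsSl2Triple hx ex fx := by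
    refine ⟨hne, ?_, ?_, ?_⟩
    · ext w; simp [Ring.lie_def, P.xef]
    · ext w; simp [Ring.lie_def, P.xhe, two_smul]
    · ext w; simp [Ring.lie_def, P.xhf, two_smul]
  have pv : t.HasPrimitiveVectorWith v a :=
    ⟨h.ne, by simpa using h.hxv, by simpa using h.ex0⟩
  exact pv.exists_nat

/-- If the first highest weight is `1`, then `e_x² = 0`. -/
theorem ex_sq (P : Sl2Pair ex fx hx ey fy hy) (h : HW ex hx ey hy a b v) (ha : a = 1) (p : F) :
    ex (ex p) = 0 := by
  have hf2 : (fx ^ 2) v = 0 := by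
    have h1 : ex ((fx ^ 2) v) = 0 := by
      rw [P.ex_pow 1 v h.ex0, h.hxv, ha]
      simp
    have h2 : ey ((fx ^ 2) v) = 0 := by
      rw [P.swap.ex_fypow, h.ey0, map_zero]
    obtain ⟨c, hc⟩ := P.hw_unique h _ h1 h2
    have h3 := P.hx_pow 2 v
    rw [h.hxv, ha, ← sub_smul, map_smul, hc, map_smul, h.hxv, ha, one_smul] at h3
    rw [hc]
    have h4 : (4 : ℂ) • c • v = 0 := by
      rw [← sub_eq_zero] at h3
      rw [← h3]
      push_cast
      module
    exact (smul_eq_zero.1 h4).resolve_left (by norm_num)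
  have hle : nspan fx fy (Submodule.span ℂ {v}) ≤ LinearMap.ker (ex ∘ₗ ex) := by
    refine Submodule.span_le.2 ?_
    rintro _ ⟨i, j, s, hs, rfl⟩
    obtain ⟨c, rfl⟩ := Submodule.mem_span_singleton.1 hs
    change ex (ex ((fx ^ i) ((fy ^ j) (c • v)))) = 0
    rw [P.pow_comm, P.ex_fypow, P.ex_fypow]
    have h0 : ex (c • v) = 0 := by rw [map_smul, h.ex0, smul_zero]
    rcases i with _ | _ | i
    · simp [h0]
    · rw [P.ex_pow 0 _ h0]
      simp [h.hxv, h.ex0]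
    · have h2 : (fx ^ (i + 2)) (c • v) = 0 := by
        rw [pow_add, Module.End.mul_apply, map_smul, hf2, smul_zero, map_zero]
      rw [h2, map_zero, map_zero, map_zero]
  rw [P.nspan_top h] at hle
  exact hle (x := p) trivial

theorem branch (P : Sl2Pair ex fx hx ey fy hy) [FiniteDimensional ℂ F]
    (h : HW ex hx ey hy a b v) (t c : ℂ) (q1 q2 q3 r : F) (hey : ∀ p, ey p = 0)
    (h3 : ex q3 = 0) (h2 : ex q2 = -q3) (h1 : ex q1 = (2 : ℂ) • q2) (hr : ex r = 0)
    (X1 : (2 - 2 * t) • q1 - hx q1 + (2 : ℂ) • fx q2 = 0)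
    (Y1 : (-2 - 2 * c) • q1 - hx q1 + (2 : ℂ) • fx q2 = 0)
    (X2 : (2 * t - 2) • q2 + hx q2 + (2 : ℂ) • fx q3 + r = 0)
    (Y2 : (2 * c + 2) • q2 + hx q2 + (2 : ℂ) • fx q3 = 0) :
    r = 0 ∧ ((q2 = 0 ∧ q3 = 0 ∧ ∃ g : ℂ, q1 = g • v ∧
        (g ≠ 0 → t = 1 - a / 2 ∧ c = -1 - a / 2)) ∨
      (∃ g : ℂ, g ≠ 0 ∧ ∃ n : ℕ, 1 < n ∧ a = n ∧ t = 2 + (n : ℂ) / 2 ∧ c = (n : ℂ) / 2 ∧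
        q3 = g • v ∧ q2 = -(g * (n : ℂ)⁻¹) • fx v ∧
        q1 = -(g * ((n : ℂ) * ((n : ℂ) - 1))⁻¹) • fx (fx v))) := by
  obtain ⟨n, hn⟩ := P.exists_nat h
  obtain ⟨g, rfl⟩ := P.hw_unique h q3 h3 (hey _)
  have hv0 := h.ne
  have cancel : ∀ z : ℂ, z • v = 0 → z = 0 := fun z hz => (smul_eq_zero.1 hz).resolve_right hv0
  have exh : ∀ p, ex (hx p) = hx (ex p) - (2 : ℂ) • ex p := fun p => by rw [P.xhe]; abel
  have exfv : ex (fx v) = a • v := by rw [P.xef, h.ex0, map_zero, zero_add, h.hxv]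
  have hfv : hx (fx v) = (a - 2) • fx v := by
    rw [P.xhf, h.hxv, map_smul]; module
  have hffv : hx (fx (fx v)) = (a - 4) • fx (fx v) := by
    rw [P.xhf, hfv, map_smul]; module
  have exffv : ex (fx (fx v)) = (2 * a - 2) • fx v := by
    rw [P.xef, exfv, hfv, map_smul]; module
  by_cases hg : g = 0
  · subst hg
    rw [zero_smul, neg_zero] at h2
    rw [zero_smul, map_zero, smul_zero, add_zero] at X2 Y2
    obtain ⟨d, rfl⟩ := P.hw_unique h q2 h2 (hey _)
    have hd : d = 0 := by
      by_contra hd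
      rw [map_smul, h.hxv] at Y2
      have e1 : (2 * c + 2 + a) * d = 0 := cancel _ (by rw [← Y2]; module)
      have e2 := congrArg ex Y1
      simp only [map_add, map_sub, map_smul, map_zero, exh, h1, h.hxv, exfv] at e2
      have e3 : (-4 * c) * d = 0 := cancel _ (by rw [← e2]; module)
      have e4 : c = 0 := by
        rcases mul_eq_zero.1 e3 with e | e
        · linear_combination (-1 / 4 : ℂ) * e
        · exact absurd e hd
      have e5 := (mul_eq_zero.1 e1).resolve_right hd
      rw [e4, hn] at e5
      have : ((n + 2 : ℕ) : ℂ) = 0 := by push_cast; linear_combination e5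
      rw [Nat.cast_eq_zero] at this
      omega
    subst hd
    rw [zero_smul, smul_zero] at h1
    obtain ⟨k, rfl⟩ := P.hw_unique h q1 h1 (hey _)
    refine ⟨by simpa using X2, Or.inl ⟨by simp, by simp, k, rfl, fun hk => ?_⟩⟩
    simp only [map_smul, h.hxv, zero_smul, map_zero, smul_zero, add_zero] at X1 Y1
    have e1 : (2 - 2 * t - a) * k = 0 := cancel _ (by rw [← X1]; module)
    have e2 : (-2 - 2 * c - a) * k = 0 := cancel _ (by rw [← Y1]; module)
    have e3 := (mul_eq_zero.1 e1).resolve_right hk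
    have e4 := (mul_eq_zero.1 e2).resolve_right hk
    exact ⟨by linear_combination (-1 / 2 : ℂ) * e3, by linear_combination (-1 / 2 : ℂ) * e4⟩
  · have e1 := congrArg ex Y2
    simp only [map_add, map_sub, map_smul, map_neg, map_zero, exh, h2, h.hxv, exfv] at e1
    have e2 : (a - 2 * c) * g = 0 := cancel _ (by rw [← e1]; module)
    have e3 := congrArg ex X2
    simp only [map_add, map_sub, map_smul, map_neg, map_zero, exh, h2, h.hxv, exfv, hr] at e3
    have e4 : (a - 2 * t + 4) * g = 0 := cancel _ (by rw [← e3]; module)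
    have hc : c = a / 2 := by
      linear_combination (-1 / 2 : ℂ) * (mul_eq_zero.1 e2).resolve_right hg
    have ht : t = 2 + a / 2 := by
      linear_combination (-1 / 2 : ℂ) * (mul_eq_zero.1 e4).resolve_right hg
    have ha0 : a ≠ 0 := by
      intro ha
      rw [(P.triv_x h ha q2).1, eq_comm, neg_eq_zero, smul_eq_zero] at h2
      exact h2.elim hg hv0
    have ha1 : a ≠ 1 := by
      intro ha
      have e := P.ex_sq h ha q1
      rw [h1, map_smul, h2, smul_neg, neg_eq_zero, smul_smul, smul_eq_zero, mul_eq_zero] at e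
      rcases e with (e | e) | e
      · exact two_ne_zero e
      · exact hg e
      · exact hv0 e
    have ha1' : a - 1 ≠ 0 := sub_ne_zero.2 ha1
    have hn1 : 1 < n := by
      rcases n with _ | _ | n
      · exact absurd (by simpa using hn) ha0
      · exact absurd (by simpa using hn) ha1
      · omega
    have ap1 : (2 * a + 2 : ℂ) ≠ 0 := by
      rw [hn]
      have : ((2 * n + 2 : ℕ) : ℂ) ≠ 0 := Nat.cast_ne_zero.2 (by omega)
      simpa using this
    have hq2 : q2 = -(g * a⁻¹) • fx v := by
      obtain ⟨d, hd⟩ := P.hw_unique h (q2 + (g * a⁻¹) • fx v)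
        (by rw [map_add, map_smul, h2, exfv, smul_smul, mul_assoc, inv_mul_cancel₀ ha0]; module)
        (hey _)
      have hq : q2 = d • v - (g * a⁻¹) • fx v := by rw [← hd]; abel
      rw [hq] at Y2
      simp only [map_sub, map_smul, h.hxv, hfv, hc] at Y2
      have e5 : ((2 * a + 2) * d) • v = 0 := by
        rw [← Y2]
        match_scalars
        · ring
        · field_simp
          ring
      have := cancel _ e5
      have hd0 : d = 0 := (mul_eq_zero.1 this).resolve_left ap1
      rw [hq, hd0]
      module
    have hr0 : r = 0 := by
      rw [hq2] at X2
      simp only [map_smul, hfv, ht] at X2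
      rw [← X2]
      match_scalars
      · ring
      · field_simp
        ring
    have hq1 : q1 = -(g * (a * (a - 1))⁻¹) • fx (fx v) := by
      obtain ⟨d, hd⟩ := P.hw_unique h (q1 + (g * (a * (a - 1))⁻¹) • fx (fx v))
        (by
          rw [map_add, map_smul, h1, exffv, hq2]
          match_scalars
          field_simp
          ring)
        (hey _)
      have hq : q1 = d • v - (g * (a * (a - 1))⁻¹) • fx (fx v) := by rw [← hd]; abel
      rw [hq, hq2] at Y1
      simp only [map_sub, map_smul, h.hxv, hffv, hc] at Y1
      have e5 : ((2 * a + 2) * d) • v = 0 := by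
        rw [← neg_eq_zero, ← Y1]
        match_scalars
        · ring
        · field_simp
          ring
      have := cancel _ e5
      have hd0 : d = 0 := (mul_eq_zero.1 this).resolve_left ap1
      rw [hq, hd0]
      module
    refine ⟨hr0, Or.inr ⟨g, hg, n, hn1, hn, ?_, ?_, rfl, ?_, ?_⟩⟩
    · rw [ht, hn]
    · rw [hc, hn]
    · rw [hq2, hn]
    · rw [hq1, hn]

/-- The vectors of `branch` do satisfy the equations. -/
theorem branch_conv (P : Sl2Pair ex fx hx ey fy hy)
    (h : HW ex hx ey hy a b v) (n : ℕ) (hn : 1 < n) (ha : a = n) (t c : ℂ)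
    (ht : t = 2 + (n : ℂ) / 2) (hc : c = (n : ℂ) / 2) (q1 q2 q3 : F)
    (h3 : q3 = v) (h2 : q2 = -((n : ℂ)⁻¹) • fx v)
    (h1 : q1 = -(((n : ℂ) * ((n : ℂ) - 1))⁻¹) • fx (fx v)) :
    ex q3 = 0 ∧ ex q2 = -q3 ∧ ex q1 = (2 : ℂ) • q2 ∧
    (2 - 2 * t) • q1 - hx q1 + (2 : ℂ) • fx q2 = 0 ∧
    (-2 - 2 * c) • q1 - hx q1 + (2 : ℂ) • fx q2 = 0 ∧
    (2 * t - 2) • q2 + hx q2 + (2 : ℂ) • fx q3 = 0 ∧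
    (2 * c + 2) • q2 + hx q2 + (2 : ℂ) • fx q3 = 0 := by
  have exfv : ex (fx v) = (n : ℂ) • v := by rw [P.xef, h.ex0, map_zero, zero_add, h.hxv, ha]
  have hfv : hx (fx v) = ((n : ℂ) - 2) • fx v := by
    rw [P.xhf, h.hxv, map_smul, ha]; module
  have hffv : hx (fx (fx v)) = ((n : ℂ) - 4) • fx (fx v) := by
    rw [P.xhf, hfv, map_smul]; module
  have exffv : ex (fx (fx v)) = (2 * (n : ℂ) - 2) • fx v := by
    rw [P.xef, exfv, hfv, map_smul]; module
  have n0 : (n : ℂ) ≠ 0 := Nat.cast_ne_zero.2 (by omega)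
  have n1 : (n : ℂ) - 1 ≠ 0 := sub_ne_zero.2 (by exact_mod_cast (by omega : n ≠ 1))
  subst h1 h2 h3
  simp only [map_smul, exfv, hfv, hffv, exffv, ht, hc, h.ex0, true_and]
  refine ⟨?_, ?_, ?_, ?_, ?_, ?_⟩ <;>
  · match_scalars
    field_simp
    try ring

end Sl2Pair
end Rep
end Sing2

namespace Sing2

section Verma

open Complex

variable {F : Type*} [AddCommGroup F] [Module ℂ F]

/-- Coefficient of the first term of the bracket. -/
def cf1 (m : ℕ) (I : Idx) (n : ℕ) (J : Idx) : ℤ :=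
  (2 * (n : ℤ) - 2 * (m : ℤ) - (n : ℤ) * I.card + (m : ℤ) * J.card) *
    if Disjoint I J then msign I J else 0

/-- Coefficients of the second term of the bracket. -/
def cf2 (I J : Idx) (i : Fin 4) : ℤ :=
  (-1) ^ I.card * if i ∈ I ∧ i ∈ J ∧ Disjoint (I.erase i) (J.erase i) then
    dsign i I * dsign i J * msign (I.erase i) (J.erase i) else 0

/-- Integral version of the cocycle. -/
def psiZ (m : ℕ) (I : Idx) (n : ℕ) (J : Idx) : ℤ :=
  if m = 0 ∧ n = 0 then
  (if I = (∅ : Idx) ∧ J = (Finset.univ : Idx) then -2 else 0)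
  + (if I = (Finset.univ : Idx) ∧ J = (∅ : Idx) then 2 else 0)
  + ∑ i : Fin 4, (if I = ({i} : Idx) ∧ J = ({i}ᶜ : Idx) then -(dsign i Finset.univ) else 0)
  + ∑ i : Fin 4, (if I = ({i}ᶜ : Idx) ∧ J = ({i} : Idx) then -(dsign i Finset.univ) else 0)
  else 0

theorem brk_eq (ρC : F →ₗ[ℂ] F) (act : ℕ → Idx → (VInd F →ₗ[ℂ] VInd F))
    (m : ℕ) (I : Idx) (n : ℕ) (J : Idx) :
    brkAct ρC act m I n J = (cf1 m I n J : ℂ) • act (m + n - 1) (I ∪ J)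
      + ∑ i : Fin 4, (cf2 I J i : ℂ) • act (m + n) (I.erase i ∪ J.erase i)
      + (psiZ m I n J : ℂ) • Cop ρC := by
  unfold brkAct
  congr 1
  · congr 1
    · unfold cf1
      split_ifs <;> simp [smul_smul]
    · rw [Finset.smul_sum]
      refine Finset.sum_congr rfl fun i _ => ?_
      unfold cf2
      split_ifs <;> simp [smul_smul]
  · congr 1
    unfold psiZ psi0
    split_ifs <;> simp

variable {D : VermaData F}

/-- Master commutation rule. -/
theorem comm (hD : IsVerma D) {m : ℕ} {I : Idx} {n : ℕ} {J : Idx} (a s p σ : ℤ) (i : Fin 4)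
    (K1 K2 : Idx)
    (h : cf1 m I n J = a ∧ (a = 0 ∨ I ∪ J = K1) ∧ (∀ j, j ≠ i → cf2 I J j = 0) ∧
      cf2 I J i = s ∧ (s = 0 ∨ I.erase i ∪ J.erase i = K2) ∧ psiZ m I n J = p ∧
      (-1) ^ (I.card * J.card) = σ) (x : VInd F) :
    D.act m I (D.act n J x) = (σ : ℂ) • D.act n J (D.act m I x)
      + ((a : ℂ) • D.act (m + n - 1) K1 x + (s : ℂ) • D.act (m + n) K2 x
        + (p : ℂ) • Cop D.ρC x) := by
  obtain ⟨h1, h2, h3, h4, h5, h6, h7⟩ := h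
  have key := LinearMap.congr_fun (hD.lie m I n J) x
  rw [brk_eq, h1, h6, Finset.sum_eq_single i (fun j _ hj => by rw [h3 j hj]; simp)
    (fun hi => absurd (Finset.mem_univ i) hi), h4] at key
  have e1 : (a : ℂ) • D.act (m + n - 1) (I ∪ J) = (a : ℂ) • D.act (m + n - 1) K1 := by
    rcases h2 with h | h
    · simp [h]
    · rw [h]
  have e2 : (s : ℂ) • D.act (m + n) (I.erase i ∪ J.erase i) = (s : ℂ) • D.act (m + n) K2 := by
    rcases h5 with h | h
    · simp [h]
    · rw [h]
  have e3 : ((-1 : ℂ) ^ (I.card * J.card)) = (σ : ℂ) := by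
    rw [← h7]; push_cast; rfl
  rw [e1, e2, e3] at key
  simp only [LinearMap.sub_apply, LinearMap.comp_apply, LinearMap.smul_apply,
    LinearMap.add_apply] at key
  rw [← key]
  abel

theorem comm_xi (hD : IsVerma D) (n : ℕ) {i j : Fin 4} (hij : i < j) (k : Fin 4) (x : VInd F) :
    D.act 0 {i, j} (D.act n {k} x) = D.act n {k} (D.act 0 {i, j} x)
      + (if k = i then D.act n {j} x else 0) - (if k = j then D.act n {i} x else 0) := by
  have h0 : ∀ i j k : Fin 4, i < j →
      msign {i, j} {k} * 0 = 0 ∧ (∀ l, l ≠ k → cf2 {i, j} {k} l = 0) ∧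
      cf2 {i, j} {k} k = (if k = i then 1 else if k = j then -1 else 0) ∧
      ((if k = i then (1 : ℤ) else if k = j then -1 else 0) = 0 ∨
        ({i, j} : Idx).erase k ∪ ({k} : Idx).erase k = if k = i then {j} else {i}) ∧
      psiZ 0 {i, j} 0 {k} = 0 ∧ (-1 : ℤ) ^ (({i, j} : Idx).card * ({k} : Idx).card) = 1 := by
    decide
  obtain ⟨-, h2, h3, h4, h5, h6⟩ := h0 i j k hij
  have h1 : cf1 0 {i, j} n {k} = 0 := by
    have : ({i, j} : Idx).card = 2 := Finset.card_pair hij.ne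
    unfold cf1
    rw [this]
    push_cast
    ring
  have h5' : psiZ 0 {i, j} n {k} = 0 := by
    rcases n with _ | n
    · exact h5
    · simp [psiZ]
  rw [comm hD 0 _ 0 1 k ∅ _ ⟨h1, Or.inl rfl, h2, h3, h4, h5', h6⟩]
  have := hij.ne
  split_ifs with c1 c2
  · exact absurd (c1.symm.trans c2) this
  · simp
  · simp [sub_eq_add_neg]
  · simp

theorem comm_t (hD : IsVerma D) (k : Fin 4) (x : VInd F) :
    D.act 1 ∅ (D.act 0 {k} x) = D.act 0 {k} (D.act 1 ∅ x) - D.act 0 {k} x := by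
  have h : ∀ k : Fin 4, cf1 1 ∅ 0 {k} = -1 ∧ ((-1 : ℤ) = 0 ∨ (∅ : Idx) ∪ {k} = {k}) ∧
    (∀ j, j ≠ k → cf2 ∅ {k} j = 0) ∧ cf2 ∅ {k} k = 0 ∧ ((0 : ℤ) = 0 ∨
    (∅ : Idx).erase k ∪ ({k} : Idx).erase k = ∅) ∧ psiZ 1 ∅ 0 {k} = 0 ∧
    (-1 : ℤ) ^ ((∅ : Idx).card * ({k} : Idx).card) = 1 := by decide
  rw [comm hD _ _ _ _ _ _ _ (h k)]
  simp [sub_eq_add_neg]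

theorem comm_txi (hD : IsVerma D) (k i : Fin 4) (x : VInd F) :
    D.act 1 {k} (D.act 0 {i} x) = -D.act 0 {i} (D.act 1 {k} x)
      - (if k = i then D.act 1 ∅ x else if k < i then D.act 0 {k, i} x
          else -D.act 0 {i, k} x) := by
  have h : ∀ k i : Fin 4,
      cf1 1 {k} 0 {i} = (if k = i then 0 else if k < i then -1 else 1) ∧
      ((if k = i then (0 : ℤ) else if k < i then -1 else 1) = 0 ∨
        ({k} : Idx) ∪ {i} = if k < i then {k, i} else {i, k}) ∧
      (∀ j, j ≠ i → cf2 {k} {i} j = 0) ∧ cf2 {k} {i} i = (if k = i then -1 else 0) ∧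
      ((if k = i then (-1 : ℤ) else 0) = 0 ∨
        ({k} : Idx).erase i ∪ ({i} : Idx).erase i = ∅) ∧ psiZ 1 {k} 0 {i} = 0 ∧
      (-1 : ℤ) ^ (({k} : Idx).card * ({i} : Idx).card) = -1 := by decide
  rw [comm hD _ _ _ _ _ _ _ (h k i)]
  split_ifs with c1 c2 <;> simp [sub_eq_add_neg]

/-- The dual elements `ξ*_k`. -/
noncomputable def star (D : VermaData F) (k : Fin 4) : VInd F →ₗ[ℂ] VInd F :=
  (dsign k Finset.univ : ℂ) • D.act 0 {k}ᶜ

theorem comm_star (hD : IsVerma D) {i j : Fin 4} (hij : i < j) (k : Fin 4) (x : VInd F) :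
    D.act 0 {i, j} (star D k x) = star D k (D.act 0 {i, j} x)
      + (if k = i then star D j x else 0) - (if k = j then star D i x else 0) := by
  have h0 : ∀ i j k : Fin 4, i < j →
      cf1 0 {i, j} 0 {k}ᶜ = 0 ∧ ((0 : ℤ) = 0 ∨ ({i, j} : Idx) ∪ {k}ᶜ = ∅) ∧
      (∀ l, l ≠ (if k = i then j else i) → cf2 {i, j} {k}ᶜ l = 0) ∧
      cf2 {i, j} {k}ᶜ (if k = i then j else i) = (if k = i then
        dsign k univ * dsign j univ else if k = j then
        - dsign k univ * dsign i univ else 0) ∧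
      ((if k = i then
        dsign k univ * dsign j univ else if k = j then
        - dsign k univ * dsign i univ else 0) = 0 ∨
        ({i, j} : Idx).erase (if k = i then j else i) ∪
          ({k}ᶜ : Idx).erase (if k = i then j else i) = {if k = i then j else i}ᶜ) ∧
      psiZ 0 {i, j} 0 {k}ᶜ = 0 ∧ (-1 : ℤ) ^ (({i, j} : Idx).card * ({k}ᶜ : Idx).card) = 1 := by
    decide
  have hs : ∀ k : Fin 4, dsign k univ * dsign k univ = 1 := by decide
  have hs' : (dsign k univ : ℂ) * (dsign k univ : ℂ) = 1 := by exact_mod_cast hs k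
  unfold star
  simp only [LinearMap.smul_apply, map_smul]
  rw [comm hD _ _ _ _ _ _ _ (h0 i j k hij)]
  have := hij.ne
  split_ifs with c1 c2
  · exact absurd (c1.symm.trans c2) this
  · simp only [Int.cast_one, Int.cast_zero, Int.cast_mul, zero_smul, smul_add, smul_smul, one_smul,
      zero_add, add_zero, mul_one, sub_zero, ← mul_assoc, hs', one_mul]
  · simp only [Int.cast_one, Int.cast_zero, Int.cast_mul, Int.cast_neg, zero_smul, smul_add,
      smul_smul, one_smul, neg_mul, mul_neg, neg_smul, smul_neg,
      zero_add, add_zero, mul_one, sub_eq_add_neg, ← mul_assoc, hs', one_mul]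
  · simp

theorem comm_star0 (hD : IsVerma D) (i : Fin 4) (x : VInd F) :
    star D 0 (D.act 0 {i} x) = -D.act 0 {i} (star D 0 x)
      + (if i = 0 then -Cop D.ρC x else if i = 1 then -D.act 0 {2, 3} x
          else if i = 2 then D.act 0 {1, 3} x else -D.act 0 {1, 2} x) := by
  have h : ∀ i : Fin 4, cf1 0 {0}ᶜ 0 {i} = 0 ∧ ((0 : ℤ) = 0 ∨ ({0}ᶜ : Idx) ∪ {i} = ∅) ∧
      (∀ j, j ≠ i → cf2 {0}ᶜ {i} j = 0) ∧
      cf2 {0}ᶜ {i} i = (if i = 0 then 0 else if i = 2 then 1 else -1) ∧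
      ((if i = 0 then (0 : ℤ) else if i = 2 then 1 else -1) = 0 ∨
        ({0}ᶜ : Idx).erase i ∪ ({i} : Idx).erase i =
          if i = 1 then {2, 3} else if i = 2 then {1, 3} else {1, 2}) ∧
      psiZ 0 {0}ᶜ 0 {i} = (if i = 0 then -1 else 0) ∧
      (-1 : ℤ) ^ (({0}ᶜ : Idx).card * ({i} : Idx).card) = -1 := by decide
  have hd : dsign 0 (univ : Idx) = 1 := by decide
  unfold star
  rw [hd]
  simp only [Int.cast_one, one_smul]
  rw [comm hD _ _ _ _ _ _ _ (h i)]
  fin_cases i <;> simp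

theorem comm_star1 (hD : IsVerma D) (i : Fin 4) (x : VInd F) :
    star D 1 (D.act 0 {i} x) = -D.act 0 {i} (star D 1 x)
      + (if i = 1 then -Cop D.ρC x else if i = 0 then D.act 0 {2, 3} x
          else if i = 2 then -D.act 0 {0, 3} x else D.act 0 {0, 2} x) := by
  have h : ∀ i : Fin 4, cf1 0 {1}ᶜ 0 {i} = 0 ∧ ((0 : ℤ) = 0 ∨ ({1}ᶜ : Idx) ∪ {i} = ∅) ∧
      (∀ j, j ≠ i → cf2 {1}ᶜ {i} j = 0) ∧
      cf2 {1}ᶜ {i} i = (if i = 1 then 0 else if i = 2 then 1 else -1) ∧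
      ((if i = 1 then (0 : ℤ) else if i = 2 then 1 else -1) = 0 ∨
        ({1}ᶜ : Idx).erase i ∪ ({i} : Idx).erase i =
          if i = 0 then {2, 3} else if i = 2 then {0, 3} else {0, 2}) ∧
      psiZ 0 {1}ᶜ 0 {i} = (if i = 1 then 1 else 0) ∧
      (-1 : ℤ) ^ (({1}ᶜ : Idx).card * ({i} : Idx).card) = -1 := by decide
  have hd : dsign 1 (univ : Idx) = -1 := by decide
  unfold star
  rw [hd]
  simp only [LinearMap.smul_apply, map_smul, Int.cast_neg, Int.cast_one]
  rw [comm hD _ _ _ _ _ _ _ (h i)]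
  fin_cases i <;> simp

end Verma
end Sing2

namespace Sing2

set_option linter.unusedSimpArgs false
set_option linter.unnecessarySeqFocus false
set_option linter.unusedTactic false
set_option linter.unreachableTactic false

section Ops

open Complex

variable {F : Type*} [AddCommGroup F] [Module ℂ F] {D : VermaData F}

/-- The vacuum embedding `v ↦ 1 ⊗ v`. -/
noncomputable def vac : F →ₗ[ℂ] VInd F := Finsupp.lsingle (0, ∅)

/-- Left multiplication by `w₁₁`. -/
noncomputable def W11 (D : VermaData F) : VInd F →ₗ[ℂ] VInd F := D.act 0 {1} + I • D.act 0 {0}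
/-- Left multiplication by `w₂₂`. -/
noncomputable def W22 (D : VermaData F) : VInd F →ₗ[ℂ] VInd F := D.act 0 {1} - I • D.act 0 {0}
/-- Left multiplication by `w₁₂`. -/
noncomputable def W12 (D : VermaData F) : VInd F →ₗ[ℂ] VInd F := -D.act 0 {3} + I • D.act 0 {2}
/-- Left multiplication by `w₂₁`. -/
noncomputable def W21 (D : VermaData F) : VInd F →ₗ[ℂ] VInd F := D.act 0 {3} + I • D.act 0 {2}

/-- The operator of `e_x` on `Ind F`. -/
noncomputable def Ex (D : VermaData F) : VInd F →ₗ[ℂ] VInd F :=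
  (2 : ℂ)⁻¹ • (-D.act 0 {0, 2} - D.act 0 {1, 3} + I • D.act 0 {1, 2} - I • D.act 0 {0, 3})
/-- The operator of `e_y` on `Ind F`. -/
noncomputable def Ey (D : VermaData F) : VInd F →ₗ[ℂ] VInd F :=
  (2 : ℂ)⁻¹ • (-D.act 0 {0, 2} + D.act 0 {1, 3} + I • D.act 0 {1, 2} + I • D.act 0 {0, 3})
/-- The operator of `f_x` on `Ind F`. -/
noncomputable def Fx (D : VermaData F) : VInd F →ₗ[ℂ] VInd F :=
  (2 : ℂ)⁻¹ • (D.act 0 {0, 2} + D.act 0 {1, 3} - I • D.act 0 {0, 3} + I • D.act 0 {1, 2})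
/-- The operator of `f_y` on `Ind F`. -/
noncomputable def Fy (D : VermaData F) : VInd F →ₗ[ℂ] VInd F :=
  (2 : ℂ)⁻¹ • (D.act 0 {0, 2} - D.act 0 {1, 3} + I • D.act 0 {0, 3} + I • D.act 0 {1, 2})
/-- The operator of `h_x` on `Ind F`. -/
noncomputable def Hx (D : VermaData F) : VInd F →ₗ[ℂ] VInd F :=
  -(I • D.act 0 {0, 1}) + I • D.act 0 {2, 3}
/-- The operator of `h_y` on `Ind F`. -/
noncomputable def Hy (D : VermaData F) : VInd F →ₗ[ℂ] VInd F :=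
  -(I • D.act 0 {0, 1}) - I • D.act 0 {2, 3}
/-- The lowest vector of the span of the `tξ_k`. -/
noncomputable def Xo (D : VermaData F) : VInd F →ₗ[ℂ] VInd F := D.act 1 {1} - I • D.act 1 {0}
/-- The lowest vector of the span of the `ξ*_k`. -/
noncomputable def Yo (D : VermaData F) : VInd F →ₗ[ℂ] VInd F := star D 1 - I • star D 0

/-- `e_x` on `F`. -/
noncomputable def exF (D : VermaData F) : F →ₗ[ℂ] F := (2 : ℂ)⁻¹ • (e1F D + e2F D)
/-- `e_y` on `F`. -/
noncomputable def eyF (D : VermaData F) : F →ₗ[ℂ] F := (2 : ℂ)⁻¹ • (e1F D - e2F D)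

theorem xi_vac (hD : IsVerma D) {i j : Fin 4} (h : i < j) (v : F) :
    D.act 0 {i, j} (vac v) = vac (D.ρξ i j v) := hD.vac_xi v i j h

theorem T_vac (hD : IsVerma D) (v : F) : D.act 1 ∅ (vac v) = vac (D.ρt v) := hD.vac_t v

theorem pos_vac (hD : IsVerma D) (m : ℕ) (J : Idx) (h : 2 < 2 * m + J.card) (v : F) :
    D.act m J (vac v) = 0 := hD.vac_pos v m J h

theorem C_vac (v : F) : Cop D.ρC (vac v) = vac (D.ρC v) := by
  simp [Cop, vac, Finsupp.mapRange.linearMap_apply]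

theorem low_bv (hD : IsVerma D) (v : F) (k : ℕ) (L : Idx) (i : Fin 4) :
    D.act 0 {i} (bv k L v) =
        if i ∈ L then ((dsign i L : ℤ) : ℂ) • bv (k + 1) (L.erase i) v
        else ((msign {i} L : ℤ) : ℂ) • bv k (insert i L) v := hD.low_eta v k L i

theorem C_act (hD : IsVerma D) (i : Fin 4) (x : VInd F) :
    Cop D.ρC (D.act 0 {i} x) = D.act 0 {i} (Cop D.ρC x) := by
  induction x using Finsupp.induction_linear with
  | zero => simp
  | add f g hf hg => simp [hf, hg]
  | single p v =>
    have h : ∀ (k : ℕ) (L : Idx) (v : F), Cop D.ρC (bv k L v) = bv k L (D.ρC v) := by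
      intro k L v
      simp [Cop, bv, Finsupp.mapRange.linearMap_apply]
    change Cop D.ρC (D.act 0 {i} (bv p.1 p.2 v)) = D.act 0 {i} (Cop D.ρC (bv p.1 p.2 v))
    rw [h, low_bv hD, low_bv hD]
    split_ifs <;> rw [map_smul, h]

theorem Ex_vac (hD : IsVerma D) (v : F) : Ex D (vac v) = vac (exF D v) := by
  simp only [Ex, exF, e1F, e2F, LinearMap.smul_apply, LinearMap.add_apply, LinearMap.sub_apply,
    LinearMap.neg_apply, xi_vac hD (show (0 : Fin 4) < 1 by decide),
    xi_vac hD (show (0 : Fin 4) < 2 by decide), xi_vac hD (show (0 : Fin 4) < 3 by decide),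
    xi_vac hD (show (1 : Fin 4) < 2 by decide), xi_vac hD (show (1 : Fin 4) < 3 by decide),
    xi_vac hD (show (2 : Fin 4) < 3 by decide), map_add, map_sub, map_neg, map_smul]
  try module

theorem Ey_vac (hD : IsVerma D) (v : F) : Ey D (vac v) = vac (eyF D v) := by
  simp only [Ey, eyF, e1F, e2F, LinearMap.smul_apply, LinearMap.add_apply, LinearMap.sub_apply,
    LinearMap.neg_apply, xi_vac hD (show (0 : Fin 4) < 1 by decide),
    xi_vac hD (show (0 : Fin 4) < 2 by decide), xi_vac hD (show (0 : Fin 4) < 3 by decide),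
    xi_vac hD (show (1 : Fin 4) < 2 by decide), xi_vac hD (show (1 : Fin 4) < 3 by decide),
    xi_vac hD (show (2 : Fin 4) < 3 by decide), map_add, map_sub, map_neg, map_smul]
  try module

theorem Fx_vac (hD : IsVerma D) (v : F) : Fx D (vac v) = vac (fxF D v) := by
  simp only [Fx, fxF, LinearMap.smul_apply, LinearMap.add_apply, LinearMap.sub_apply,
    LinearMap.neg_apply, xi_vac hD (show (0 : Fin 4) < 1 by decide),
    xi_vac hD (show (0 : Fin 4) < 2 by decide), xi_vac hD (show (0 : Fin 4) < 3 by decide),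
    xi_vac hD (show (1 : Fin 4) < 2 by decide), xi_vac hD (show (1 : Fin 4) < 3 by decide),
    xi_vac hD (show (2 : Fin 4) < 3 by decide), map_add, map_sub, map_neg, map_smul]
  try module

theorem Fy_vac (hD : IsVerma D) (v : F) : Fy D (vac v) = vac (fyF D v) := by
  simp only [Fy, fyF, LinearMap.smul_apply, LinearMap.add_apply, LinearMap.sub_apply,
    LinearMap.neg_apply, xi_vac hD (show (0 : Fin 4) < 1 by decide),
    xi_vac hD (show (0 : Fin 4) < 2 by decide), xi_vac hD (show (0 : Fin 4) < 3 by decide),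
    xi_vac hD (show (1 : Fin 4) < 2 by decide), xi_vac hD (show (1 : Fin 4) < 3 by decide),
    xi_vac hD (show (2 : Fin 4) < 3 by decide), map_add, map_sub, map_neg, map_smul]
  try module

theorem Hx_vac (hD : IsVerma D) (v : F) : Hx D (vac v) = vac (hxF D v) := by
  simp only [Hx, hxF, LinearMap.smul_apply, LinearMap.add_apply, LinearMap.sub_apply,
    LinearMap.neg_apply, xi_vac hD (show (0 : Fin 4) < 1 by decide),
    xi_vac hD (show (0 : Fin 4) < 2 by decide), xi_vac hD (show (0 : Fin 4) < 3 by decide),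
    xi_vac hD (show (1 : Fin 4) < 2 by decide), xi_vac hD (show (1 : Fin 4) < 3 by decide),
    xi_vac hD (show (2 : Fin 4) < 3 by decide), map_add, map_sub, map_neg, map_smul]
  try module

theorem Hy_vac (hD : IsVerma D) (v : F) : Hy D (vac v) = vac (hyF D v) := by
  simp only [Hy, hyF, LinearMap.smul_apply, LinearMap.add_apply, LinearMap.sub_apply,
    LinearMap.neg_apply, xi_vac hD (show (0 : Fin 4) < 1 by decide),
    xi_vac hD (show (0 : Fin 4) < 2 by decide), xi_vac hD (show (0 : Fin 4) < 3 by decide),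
    xi_vac hD (show (1 : Fin 4) < 2 by decide), xi_vac hD (show (1 : Fin 4) < 3 by decide),
    xi_vac hD (show (2 : Fin 4) < 3 by decide), map_add, map_sub, map_neg, map_smul]
  try module

theorem X_vac (hD : IsVerma D) (v : F) : Xo D (vac v) = 0 := by
  simp only [Xo, LinearMap.smul_apply, LinearMap.sub_apply]
  rw [pos_vac hD 1 {1} (by decide), pos_vac hD 1 {0} (by decide)]
  simp

theorem Y_vac (hD : IsVerma D) (v : F) : Yo D (vac v) = 0 := by
  simp only [Yo, star, LinearMap.smul_apply, LinearMap.sub_apply]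
  rw [pos_vac hD 0 {1}ᶜ (by decide), pos_vac hD 0 {0}ᶜ (by decide)]
  simp

theorem Ex_W (hD : IsVerma D) (x : VInd F) :
    Ex D (W11 D x) = W11 D (Ex D x) ∧
    Ex D (W22 D x) = W22 D (Ex D x) + W12 D x ∧
    Ex D (W12 D x) = W12 D (Ex D x) ∧
    Ex D (W21 D x) = W21 D (Ex D x) + W11 D x := by
  refine ⟨?_, ?_, ?_, ?_⟩ <;>
  · simp only [Ex, W11, W12, W21, W22, LinearMap.smul_apply, LinearMap.add_apply,
      LinearMap.sub_apply, LinearMap.neg_apply, map_add, map_sub, map_neg, map_smul,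
      comm_xi hD 0 (show (0 : Fin 4) < 1 by decide), comm_xi hD 0 (show (0 : Fin 4) < 2 by decide),
    comm_xi hD 0 (show (0 : Fin 4) < 3 by decide), comm_xi hD 0 (show (1 : Fin 4) < 2 by decide),
    comm_xi hD 0 (show (1 : Fin 4) < 3 by decide), comm_xi hD 0 (show (2 : Fin 4) < 3 by decide)]
    try simp only [Fin.reduceEq, Fin.reduceLT, if_true, if_false, reduceIte]
    try (match_scalars <;> ring_nf <;> (try simp only [I_sq]) <;> (try ring_nf))

theorem Ey_W (hD : IsVerma D) (x : VInd F) :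
    Ey D (W11 D x) = W11 D (Ey D x) ∧
    Ey D (W22 D x) = W22 D (Ey D x) + W21 D x ∧
    Ey D (W12 D x) = W12 D (Ey D x) + W11 D x ∧
    Ey D (W21 D x) = W21 D (Ey D x) := by
  refine ⟨?_, ?_, ?_, ?_⟩ <;>
  · simp only [Ey, W11, W12, W21, W22, LinearMap.smul_apply, LinearMap.add_apply,
      LinearMap.sub_apply, LinearMap.neg_apply, map_add, map_sub, map_neg, map_smul,
      comm_xi hD 0 (show (0 : Fin 4) < 1 by decide), comm_xi hD 0 (show (0 : Fin 4) < 2 by decide),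
    comm_xi hD 0 (show (0 : Fin 4) < 3 by decide), comm_xi hD 0 (show (1 : Fin 4) < 2 by decide),
    comm_xi hD 0 (show (1 : Fin 4) < 3 by decide), comm_xi hD 0 (show (2 : Fin 4) < 3 by decide)]
    try simp only [Fin.reduceEq, Fin.reduceLT, if_true, if_false, reduceIte]
    try (match_scalars <;> ring_nf <;> (try simp only [I_sq]) <;> (try ring_nf))

theorem Fx_W (hD : IsVerma D) (x : VInd F) :
    Fx D (W11 D x) = W11 D (Fx D x) + W21 D x ∧
    Fx D (W22 D x) = W22 D (Fx D x) ∧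
    Fx D (W12 D x) = W12 D (Fx D x) + W22 D x ∧
    Fx D (W21 D x) = W21 D (Fx D x) := by
  refine ⟨?_, ?_, ?_, ?_⟩ <;>
  · simp only [Fx, W11, W12, W21, W22, LinearMap.smul_apply, LinearMap.add_apply,
      LinearMap.sub_apply, LinearMap.neg_apply, map_add, map_sub, map_neg, map_smul,
      comm_xi hD 0 (show (0 : Fin 4) < 1 by decide), comm_xi hD 0 (show (0 : Fin 4) < 2 by decide),
    comm_xi hD 0 (show (0 : Fin 4) < 3 by decide), comm_xi hD 0 (show (1 : Fin 4) < 2 by decide),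
    comm_xi hD 0 (show (1 : Fin 4) < 3 by decide), comm_xi hD 0 (show (2 : Fin 4) < 3 by decide)]
    try simp only [Fin.reduceEq, Fin.reduceLT, if_true, if_false, reduceIte]
    try (match_scalars <;> ring_nf <;> (try simp only [I_sq]) <;> (try ring_nf))

theorem Fy_W (hD : IsVerma D) (x : VInd F) :
    Fy D (W11 D x) = W11 D (Fy D x) + W12 D x ∧
    Fy D (W22 D x) = W22 D (Fy D x) ∧
    Fy D (W12 D x) = W12 D (Fy D x) ∧
    Fy D (W21 D x) = W21 D (Fy D x) + W22 D x := by
  refine ⟨?_, ?_, ?_, ?_⟩ <;>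
  · simp only [Fy, W11, W12, W21, W22, LinearMap.smul_apply, LinearMap.add_apply,
      LinearMap.sub_apply, LinearMap.neg_apply, map_add, map_sub, map_neg, map_smul,
      comm_xi hD 0 (show (0 : Fin 4) < 1 by decide), comm_xi hD 0 (show (0 : Fin 4) < 2 by decide),
    comm_xi hD 0 (show (0 : Fin 4) < 3 by decide), comm_xi hD 0 (show (1 : Fin 4) < 2 by decide),
    comm_xi hD 0 (show (1 : Fin 4) < 3 by decide), comm_xi hD 0 (show (2 : Fin 4) < 3 by decide)]
    try simp only [Fin.reduceEq, Fin.reduceLT, if_true, if_false, reduceIte]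
    try (match_scalars <;> ring_nf <;> (try simp only [I_sq]) <;> (try ring_nf))

theorem Hx_W (hD : IsVerma D) (x : VInd F) :
    Hx D (W11 D x) = W11 D (Hx D x) + W11 D x ∧
    Hx D (W22 D x) = W22 D (Hx D x) - W22 D x ∧
    Hx D (W12 D x) = W12 D (Hx D x) + W12 D x ∧
    Hx D (W21 D x) = W21 D (Hx D x) - W21 D x := by
  refine ⟨?_, ?_, ?_, ?_⟩ <;>
  · simp only [Hx, W11, W12, W21, W22, LinearMap.smul_apply, LinearMap.add_apply,
      LinearMap.sub_apply, LinearMap.neg_apply, map_add, map_sub, map_neg, map_smul,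
      comm_xi hD 0 (show (0 : Fin 4) < 1 by decide), comm_xi hD 0 (show (0 : Fin 4) < 2 by decide),
    comm_xi hD 0 (show (0 : Fin 4) < 3 by decide), comm_xi hD 0 (show (1 : Fin 4) < 2 by decide),
    comm_xi hD 0 (show (1 : Fin 4) < 3 by decide), comm_xi hD 0 (show (2 : Fin 4) < 3 by decide)]
    try simp only [Fin.reduceEq, Fin.reduceLT, if_true, if_false, reduceIte]
    try (match_scalars <;> ring_nf <;> (try simp only [I_sq]) <;> (try ring_nf))

theorem Hy_W (hD : IsVerma D) (x : VInd F) :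
    Hy D (W11 D x) = W11 D (Hy D x) + W11 D x ∧
    Hy D (W22 D x) = W22 D (Hy D x) - W22 D x ∧
    Hy D (W12 D x) = W12 D (Hy D x) - W12 D x ∧
    Hy D (W21 D x) = W21 D (Hy D x) + W21 D x := by
  refine ⟨?_, ?_, ?_, ?_⟩ <;>
  · simp only [Hy, W11, W12, W21, W22, LinearMap.smul_apply, LinearMap.add_apply,
      LinearMap.sub_apply, LinearMap.neg_apply, map_add, map_sub, map_neg, map_smul,
      comm_xi hD 0 (show (0 : Fin 4) < 1 by decide), comm_xi hD 0 (show (0 : Fin 4) < 2 by decide),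
    comm_xi hD 0 (show (0 : Fin 4) < 3 by decide), comm_xi hD 0 (show (1 : Fin 4) < 2 by decide),
    comm_xi hD 0 (show (1 : Fin 4) < 3 by decide), comm_xi hD 0 (show (2 : Fin 4) < 3 by decide)]
    try simp only [Fin.reduceEq, Fin.reduceLT, if_true, if_false, reduceIte]
    try (match_scalars <;> ring_nf <;> (try simp only [I_sq]) <;> (try ring_nf))

theorem T_W (hD : IsVerma D) (x : VInd F) :
    D.act 1 ∅ (W11 D x) = W11 D (D.act 1 ∅ x) - W11 D x ∧
    D.act 1 ∅ (W22 D x) = W22 D (D.act 1 ∅ x) - W22 D x ∧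
    D.act 1 ∅ (W12 D x) = W12 D (D.act 1 ∅ x) - W12 D x ∧
    D.act 1 ∅ (W21 D x) = W21 D (D.act 1 ∅ x) - W21 D x := by
  refine ⟨?_, ?_, ?_, ?_⟩ <;>
  · simp only [LinearMap.id_coe, W11, W12, W21, W22, LinearMap.smul_apply, LinearMap.add_apply,
      LinearMap.sub_apply, LinearMap.neg_apply, map_add, map_sub, map_neg, map_smul,
      comm_t hD]
    try simp only [Fin.reduceEq, Fin.reduceLT, if_true, if_false, reduceIte]
    try (match_scalars <;> ring_nf <;> (try simp only [I_sq]) <;> (try ring_nf))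

theorem C_W (hD : IsVerma D) (x : VInd F) :
    Cop D.ρC (W11 D x) = W11 D (Cop D.ρC x) ∧
    Cop D.ρC (W22 D x) = W22 D (Cop D.ρC x) ∧
    Cop D.ρC (W12 D x) = W12 D (Cop D.ρC x) ∧
    Cop D.ρC (W21 D x) = W21 D (Cop D.ρC x) := by
  refine ⟨?_, ?_, ?_, ?_⟩ <;>
  · simp only [LinearMap.id_coe, W11, W12, W21, W22, LinearMap.smul_apply, LinearMap.add_apply,
      LinearMap.sub_apply, LinearMap.neg_apply, map_add, map_sub, map_neg, map_smul,
      C_act hD]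
    try simp only [Fin.reduceEq, Fin.reduceLT, if_true, if_false, reduceIte]
    try (match_scalars <;> ring_nf <;> (try simp only [I_sq]) <;> (try ring_nf))

theorem X_W (hD : IsVerma D) (x : VInd F) :
    Xo D (W11 D x) = -W11 D (Xo D x) - (Hx D x + Hy D x + (2 : ℂ) • D.act 1 ∅ x) ∧
    Xo D (W22 D x) = -W22 D (Xo D x) ∧
    Xo D (W12 D x) = -W12 D (Xo D x) - (2 : ℂ) • Fy D x ∧
    Xo D (W21 D x) = -W21 D (Xo D x) - (2 : ℂ) • Fx D x := by
  refine ⟨?_, ?_, ?_, ?_⟩ <;>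
  · simp only [Xo, Fx, Fy, Hx, Hy, W11, W12, W21, W22, LinearMap.smul_apply, LinearMap.add_apply,
      LinearMap.sub_apply, LinearMap.neg_apply, map_add, map_sub, map_neg, map_smul,
      comm_txi hD]
    try simp only [Fin.reduceEq, Fin.reduceLT, if_true, if_false, reduceIte]
    try (match_scalars <;> ring_nf <;> (try simp only [I_sq]) <;> (try ring_nf))

theorem Y_W (hD : IsVerma D) (x : VInd F) :
    Yo D (W11 D x) = -W11 D (Yo D x) + (Hx D x - Hy D x - (2 : ℂ) • Cop D.ρC x) ∧
    Yo D (W22 D x) = -W22 D (Yo D x) ∧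
    Yo D (W12 D x) = -W12 D (Yo D x) - (2 : ℂ) • Fy D x ∧
    Yo D (W21 D x) = -W21 D (Yo D x) + (2 : ℂ) • Fx D x := by
  refine ⟨?_, ?_, ?_, ?_⟩ <;>
  · simp only [Yo, Fx, Fy, Hx, Hy, W11, W12, W21, W22, LinearMap.smul_apply, LinearMap.add_apply,
      LinearMap.sub_apply, LinearMap.neg_apply, map_add, map_sub, map_neg, map_smul,
      comm_star0 hD, comm_star1 hD]
    try simp only [Fin.reduceEq, Fin.reduceLT, if_true, if_false, reduceIte]
    try (match_scalars <;> ring_nf <;> (try simp only [I_sq]) <;> (try ring_nf))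

end Ops
end Sing2

namespace Sing2

set_option linter.unusedSimpArgs false

section UU

open Complex

variable {F : Type*} [AddCommGroup F] [Module ℂ F] {D : VermaData F}

theorem eta_comm (hD : IsVerma D) (i j : Fin 4) (x : VInd F) :
    D.act 0 {i} (D.act 0 {j} x) = -D.act 0 {j} (D.act 0 {i} x)
      - (if i = j then D.act 0 ∅ x else 0) := by
  have h : ∀ k i : Fin 4,
      cf1 0 {k} 0 {i} = 0 ∧ ((0 : ℤ) = 0 ∨ ({k} : Idx) ∪ {i} = ∅) ∧
      (∀ j, j ≠ i → cf2 {k} {i} j = 0) ∧ cf2 {k} {i} i = (if k = i then -1 else 0) ∧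
      ((if k = i then (-1 : ℤ) else 0) = 0 ∨
        ({k} : Idx).erase i ∪ ({i} : Idx).erase i = ∅) ∧ psiZ 0 {k} 0 {i} = 0 ∧
      (-1 : ℤ) ^ (({k} : Idx).card * ({i} : Idx).card) = -1 := by decide
  rw [comm hD _ _ _ _ _ _ _ (h i j)]
  split_ifs with c1 <;> simp [sub_eq_add_neg]

/-- `w_{12}w_{11}`, `w_{21}w_{11}`, `w_{12}w_{22}`, `w_{21} w_{22}`, `w_{12}w_{21}` reordered,
and squares. -/
theorem WW (hD : IsVerma D) (x : VInd F) :
    W12 D (W11 D x) = -W11 D (W12 D x) ∧ W21 D (W11 D x) = -W11 D (W21 D x) ∧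
    W12 D (W22 D x) = -W22 D (W12 D x) ∧ W21 D (W22 D x) = -W22 D (W21 D x) ∧
    W12 D (W21 D x) = -W21 D (W12 D x) - W11 D (W22 D x) - W22 D (W11 D x) ∧
    W11 D (W11 D x) = 0 ∧ W22 D (W22 D x) = 0 ∧ W12 D (W12 D x) = 0 ∧ W21 D (W21 D x) = 0 := by
  have s : ∀ i, D.act 0 {i} (D.act 0 {i} x) = -((2 : ℂ)⁻¹ • D.act 0 ∅ x) := by
    intro i
    have := eta_comm hD i i x
    simp only [if_true] at this
    have h2 : (2 : ℂ) • D.act 0 {i} (D.act 0 {i} x) = -D.act 0 ∅ x := by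
      rw [two_smul]
      nth_rw 1 [this]
      abel
    rw [← smul_neg, ← h2, smul_smul]
    norm_num
  have a := fun (i j : Fin 4) (h : i ≠ j) => (eta_comm hD i j x)
  have a01 := eta_comm hD 1 0 x
  have a02 := eta_comm hD 2 0 x
  have a03 := eta_comm hD 3 0 x
  have a12 := eta_comm hD 2 1 x
  have a13 := eta_comm hD 3 1 x
  have a23 := eta_comm hD 3 2 x
  simp only [Fin.reduceEq, if_false, sub_zero] at a01 a02 a03 a12 a13 a23
  refine ⟨?_, ?_, ?_, ?_, ?_, ?_, ?_, ?_, ?_⟩ <;>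
  · simp only [W11, W12, W21, W22, LinearMap.smul_apply, LinearMap.add_apply,
      LinearMap.sub_apply, LinearMap.neg_apply, map_add, map_sub, map_neg, map_smul,
      s, a01, a02, a03, a12, a13, a23]
    match_scalars <;> ring_nf <;> (try simp only [I_sq]) <;> (try ring_nf)

/-- A general element of degree 2. -/
noncomputable def U (D : VermaData F) (p1 p2 p3 q1 q2 q3 r : F) : VInd F :=
  W11 D (W12 D (vac p1)) + (W11 D (W22 D (vac p2)) + W21 D (W12 D (vac p2)))
  + W22 D (W21 D (vac p3)) + W11 D (W21 D (vac q1))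
  + (W22 D (W11 D (vac q2)) + W21 D (W12 D (vac q2))) + W22 D (W12 D (vac q3))
  + (4 : ℂ)⁻¹ • (W11 D (W22 D (vac r)) + W22 D (W11 D (vac r)))

/-- A general element of degree 1. -/
noncomputable def V (D : VermaData F) (a b c d : F) : VInd F :=
  W11 D (vac a) + W12 D (vac b) + W21 D (vac c) + W22 D (vac d)

theorem Ex_U (hD : IsVerma D) (p1 p2 p3 q1 q2 q3 r : F) :
    Ex D (U D p1 p2 p3 q1 q2 q3 r) = U D (exF D p1 + (2 : ℂ) • p2) (exF D p2 - p3) (exF D p3) (exF D q1) (exF D q2) (exF D q3)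
      (exF D r) := by
  simp only [U, V, map_add, map_sub, map_neg, map_smul, map_zero, smul_zero, neg_zero,
    fun x => (Ex_W hD x).1, fun x => (Ex_W hD x).2.1, fun x => (Ex_W hD x).2.2.1, fun x => (Ex_W hD x).2.2.2,
    Ex_vac hD,
    fun x => (WW hD x).1, fun x => (WW hD x).2.1, fun x => (WW hD x).2.2.1, fun x => (WW hD x).2.2.2.1, fun x => (WW hD x).2.2.2.2.1, fun x => (WW hD x).2.2.2.2.2.1, fun x => (WW hD x).2.2.2.2.2.2.1, fun x => (WW hD x).2.2.2.2.2.2.2.1, fun x => (WW hD x).2.2.2.2.2.2.2.2]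
  module

theorem Ey_U (hD : IsVerma D) (p1 p2 p3 q1 q2 q3 r : F) :
    Ey D (U D p1 p2 p3 q1 q2 q3 r) = U D (eyF D p1) (eyF D p2) (eyF D p3) (eyF D q1 - (2 : ℂ) • q2) (eyF D q2 + q3)
      (eyF D q3) (eyF D r) := by
  simp only [U, V, map_add, map_sub, map_neg, map_smul, map_zero, smul_zero, neg_zero,
    fun x => (Ey_W hD x).1, fun x => (Ey_W hD x).2.1, fun x => (Ey_W hD x).2.2.1, fun x => (Ey_W hD x).2.2.2,
    Ey_vac hD,
    fun x => (WW hD x).1, fun x => (WW hD x).2.1, fun x => (WW hD x).2.2.1, fun x => (WW hD x).2.2.2.1, fun x => (WW hD x).2.2.2.2.1, fun x => (WW hD x).2.2.2.2.2.1, fun x => (WW hD x).2.2.2.2.2.2.1, fun x => (WW hD x).2.2.2.2.2.2.2.1, fun x => (WW hD x).2.2.2.2.2.2.2.2]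
  module

theorem X_U (hD : IsVerma D) (p1 p2 p3 q1 q2 q3 r : F) :
    Xo D (U D p1 p2 p3 q1 q2 q3 r) = V D ((2 : ℂ) • fyF D p1 + (2 : ℂ) • fxF D q1)
      ((2 : ℂ) • p1 - hxF D p1 - hyF D p1 - (2 : ℂ) • D.ρt p1 - (2 : ℂ) • fxF D p2
        - (2 : ℂ) • fxF D q2)
      ((2 : ℂ) • fyF D p2 + ((2 : ℂ) • q1 - hxF D q1 - hyF D q1 - (2 : ℂ) • D.ρt q1)
        + (2 : ℂ) • fyF D q2)
      ((2 : ℂ) • p2 - hxF D p2 - hyF D p2 - (2 : ℂ) • D.ρt p2 + (2 : ℂ) • fxF D p3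
        + (hxF D q2 + hyF D q2 + (2 : ℂ) • D.ρt q2 - (2 : ℂ) • q2) + (2 : ℂ) • fyF D q3 + r) := by
  simp only [U, V, map_add, map_sub, map_neg, map_smul, map_zero, smul_zero, neg_zero,
    fun x => (X_W hD x).1, fun x => (X_W hD x).2.1, fun x => (X_W hD x).2.2.1, fun x => (X_W hD x).2.2.2,
    fun x => (Fx_W hD x).1, fun x => (Fx_W hD x).2.1, fun x => (Fx_W hD x).2.2.1, fun x => (Fx_W hD x).2.2.2,
    fun x => (Fy_W hD x).1, fun x => (Fy_W hD x).2.1, fun x => (Fy_W hD x).2.2.1, fun x => (Fy_W hD x).2.2.2,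
    fun x => (Hx_W hD x).1, fun x => (Hx_W hD x).2.1, fun x => (Hx_W hD x).2.2.1, fun x => (Hx_W hD x).2.2.2,
    fun x => (Hy_W hD x).1, fun x => (Hy_W hD x).2.1, fun x => (Hy_W hD x).2.2.1, fun x => (Hy_W hD x).2.2.2,
    fun x => (T_W hD x).1, fun x => (T_W hD x).2.1, fun x => (T_W hD x).2.2.1, fun x => (T_W hD x).2.2.2,
    X_vac hD, Fx_vac hD, Fy_vac hD, Hx_vac hD, Hy_vac hD, T_vac hD]
  module

theorem Y_U (hD : IsVerma D) (p1 p2 p3 q1 q2 q3 r : F) :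
    Yo D (U D p1 p2 p3 q1 q2 q3 r) = V D ((2 : ℂ) • fyF D p1 - (2 : ℂ) • fxF D q1)
      ((2 : ℂ) • p1 + hxF D p1 - hyF D p1 - (2 : ℂ) • D.ρC p1 + (2 : ℂ) • fxF D p2
        + (2 : ℂ) • fxF D q2)
      ((2 : ℂ) • fyF D p2 + (-(2 : ℂ) • q1 + hxF D q1 - hyF D q1 - (2 : ℂ) • D.ρC q1)
        + (2 : ℂ) • fyF D q2)
      ((2 : ℂ) • p2 + hxF D p2 - hyF D p2 - (2 : ℂ) • D.ρC p2 - (2 : ℂ) • fxF D p3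
        + ((2 : ℂ) • q2 - hxF D q2 + hyF D q2 + (2 : ℂ) • D.ρC q2) + (2 : ℂ) • fyF D q3) := by
  simp only [U, V, map_add, map_sub, map_neg, map_smul, map_zero, smul_zero, neg_zero,
    fun x => (Y_W hD x).1, fun x => (Y_W hD x).2.1, fun x => (Y_W hD x).2.2.1, fun x => (Y_W hD x).2.2.2,
    fun x => (Fx_W hD x).1, fun x => (Fx_W hD x).2.1, fun x => (Fx_W hD x).2.2.1, fun x => (Fx_W hD x).2.2.2,
    fun x => (Fy_W hD x).1, fun x => (Fy_W hD x).2.1, fun x => (Fy_W hD x).2.2.1, fun x => (Fy_W hD x).2.2.2,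
    fun x => (Hx_W hD x).1, fun x => (Hx_W hD x).2.1, fun x => (Hx_W hD x).2.2.1, fun x => (Hx_W hD x).2.2.2,
    fun x => (Hy_W hD x).1, fun x => (Hy_W hD x).2.1, fun x => (Hy_W hD x).2.2.1, fun x => (Hy_W hD x).2.2.2,
    fun x => (C_W hD x).1, fun x => (C_W hD x).2.1, fun x => (C_W hD x).2.2.1, fun x => (C_W hD x).2.2.2,
    Y_vac hD, Fx_vac hD, Fy_vac hD, Hx_vac hD, Hy_vac hD, C_vac]
  module

end UU
end Sing2

namespace Sing2

set_option linter.unusedSimpArgs false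
set_option linter.unusedSectionVars false

section Coord

open Complex

variable {F : Type*} [AddCommGroup F] [Module ℂ F] {D : VermaData F}

theorem tens_add (a b : CA) (v : F) : tens (a + b) v = tens a v + tens b v := by
  unfold tens
  exact Finsupp.sum_add_index' (by simp) (by intro p c d; rw [add_smul, Finsupp.single_add])

theorem tens_smul (c : ℂ) (a : CA) (v : F) : tens (c • a) v = c • tens a v := by
  unfold tens
  rw [Finsupp.sum_smul_index' (by simp), Finsupp.smul_sum]
  simp [smul_smul]

theorem tens_neg (a : CA) (v : F) : tens (-a) v = -tens a v := by
  rw [← neg_one_smul ℂ, tens_smul, neg_one_smul]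

theorem tens_sub (a b : CA) (v : F) : tens (a - b) v = tens a v - tens b v := by
  rw [sub_eq_add_neg, tens_add, tens_neg, sub_eq_add_neg]

theorem tens_single (p : ℕ × Idx) (c : ℂ) (v : F) :
    tens (Finsupp.single p c) v = c • bv p.1 p.2 v := by
  unfold tens bv
  rw [Finsupp.sum_single_index (by simp)]
  simp

theorem cmul_add_left (a b y : CA) : cmul (a + b) y = cmul a y + cmul b y := by
  unfold cmul
  refine Finsupp.sum_add_index' (by simp) ?_
  intro p c d
  rw [← Finsupp.sum_add]
  refine Finsupp.sum_congr fun q _ => ?_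
  rw [← Finsupp.single_add]
  congr 1
  ring

theorem cmul_smul_left (c : ℂ) (a y : CA) : cmul (c • a) y = c • cmul a y := by
  unfold cmul
  rw [Finsupp.sum_smul_index' (by simp), Finsupp.smul_sum]
  refine Finsupp.sum_congr fun q _ => ?_
  rw [Finsupp.smul_sum]
  refine Finsupp.sum_congr fun q _ => ?_
  rw [Finsupp.smul_single, smul_eq_mul, smul_eq_mul, mul_assoc, mul_assoc, mul_assoc]

theorem cmul_neg_left (a y : CA) : cmul (-a) y = -cmul a y := by
  rw [← neg_one_smul ℂ, cmul_smul_left, neg_one_smul]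

theorem cmul_sub_left (a b y : CA) : cmul (a - b) y = cmul a y - cmul b y := by
  rw [sub_eq_add_neg, cmul_add_left, cmul_neg_left, sub_eq_add_neg]

theorem cmul_add_right (p : ℕ × Idx) (c : ℂ) (y z : CA) :
    cmul (Finsupp.single p c) (y + z)
      = cmul (Finsupp.single p c) y + cmul (Finsupp.single p c) z := by
  unfold cmul
  rw [Finsupp.sum_single_index (by simp), Finsupp.sum_single_index (by simp),
    Finsupp.sum_single_index (by simp)]
  refine Finsupp.sum_add_index' (by simp) ?_
  intro p c d
  rw [← Finsupp.single_add]
  congr 1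
  ring

theorem bv_add (k : ℕ) (L : Idx) (v w : F) : bv k L (v + w) = bv k L v + bv k L w :=
  Finsupp.single_add _ _ _

theorem bv_smul (k : ℕ) (L : Idx) (c : ℂ) (v : F) : bv k L (c • v) = c • bv k L v := by
  simp [bv]

theorem tens_cmul_eta (hD : IsVerma D) (i : Fin 4) (y : CA) (v : F) :
    tens (cmul (Finsupp.single (0, ({i} : Idx)) 1) y) v = D.act 0 {i} (tens y v) := by
  induction y using Finsupp.induction_linear with
  | zero => simp [cmul, tens]
  | add f g hf hg => rw [cmul_add_right, tens_add, hf, hg, tens_add, map_add]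
  | single q c =>
    have hz : cmul (Finsupp.single (0, ({i} : Idx)) 1) (Finsupp.single q c) =
        Finsupp.single (0 + q.1 + (({i} : Idx) ∩ q.2).card, (({i} : Idx) \ q.2) ∪ (q.2 \ {i}))
          (1 * c * ((msign {i} q.2 : ℤ) : ℂ)) := by
      unfold cmul
      rw [Finsupp.sum_single_index (by simp), Finsupp.sum_single_index (by simp)]
    rw [hz, tens_single, tens_single, map_smul, low_bv hD]
    have h1 : ∀ (i : Fin 4) (L : Idx), i ∈ L → (({i} : Idx) ∩ L).card = 1 ∧
      (({i} : Idx) \ L) ∪ (L \ {i}) = L.erase i ∧ msign {i} L = dsign i L := by decide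
    have h2 : ∀ (i : Fin 4) (L : Idx), i ∉ L → (({i} : Idx) ∩ L).card = 0 ∧
      (({i} : Idx) \ L) ∪ (L \ {i}) = insert i L := by decide
    split_ifs with h
    · obtain ⟨e1, e2, e3⟩ := h1 i q.2 h
      simp only [e1, e2, e3, zero_add, one_mul, smul_smul]
    · obtain ⟨e1, e2⟩ := h2 i q.2 h
      simp only [e1, e2, zero_add, add_zero, one_mul, smul_smul]

theorem eta_vac (hD : IsVerma D) (i : Fin 4) (v : F) : D.act 0 {i} (vac v) = bv 0 {i} v := by
  have h : ∀ i : Fin 4, msign {i} ∅ = 1 := by decide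
  change D.act 0 {i} (bv 0 ∅ v) = _
  rw [low_bv hD, h]
  simp

theorem tens_W (hD : IsVerma D) (y : CA) (v : F) :
    tens (cmul w11 y) v = W11 D (tens y v) ∧ tens (cmul w22 y) v = W22 D (tens y v) ∧
    tens (cmul w12 y) v = W12 D (tens y v) ∧ tens (cmul w21 y) v = W21 D (tens y v) := by
  refine ⟨?_, ?_, ?_, ?_⟩ <;>
  simp only [w11, w22, w12, w21, cmul_add_left, cmul_sub_left, cmul_neg_left, cmul_smul_left,
    tens_add, tens_sub, tens_neg, tens_smul, tens_cmul_eta hD, W11, W22, W12, W21,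
    LinearMap.add_apply, LinearMap.sub_apply, LinearMap.neg_apply, LinearMap.smul_apply]

theorem tens_w (hD : IsVerma D) (v : F) :
    tens w11 v = W11 D (vac v) ∧ tens w22 v = W22 D (vac v) ∧
    tens w12 v = W12 D (vac v) ∧ tens w21 v = W21 D (vac v) := by
  refine ⟨?_, ?_, ?_, ?_⟩ <;>
  simp only [w11, w22, w12, w21, tens_add, tens_sub, tens_neg, tens_smul, tens_single, one_smul,
    W11, W22, W12, W21, eta_vac hD,
    LinearMap.add_apply, LinearMap.sub_apply, LinearMap.neg_apply, LinearMap.smul_apply]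

theorem eta2 (hD : IsVerma D) (i j : Fin 4) (v : F) : D.act 0 {i} (bv 0 {j} v) =
    if i = j then bv 1 ∅ v else if i < j then bv 0 {i, j} v else -bv 0 {j, i} v := by
  have h : ∀ i j : Fin 4, (i = j → dsign i {j} = 1 ∧ ({j} : Idx).erase i = ∅) ∧
    (i < j → msign {i} {j} = 1) ∧ (¬ i = j → ¬ i < j → msign {i} {j} = -1 ∧
      insert i ({j} : Idx) = {j, i}) := by decide
  obtain ⟨h1, h2, h3⟩ := h i j
  rw [low_bv hD]
  simp only [Finset.mem_singleton]
  split_ifs with c1 c2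
  · rw [(h1 c1).1, (h1 c1).2]; simp
  · rw [h2 c2]; simp
  · rw [(h3 c1 c2).1, (h3 c1 c2).2]; simp

theorem smulI {x : F} (h : I • x = 0) : x = 0 := (smul_eq_zero.mp h).resolve_left I_ne_zero

theorem V_zero (hD : IsVerma D) {a b c d : F} (h : V D a b c d = 0) :
    a = 0 ∧ b = 0 ∧ c = 0 ∧ d = 0 := by
  simp only [V, W11, W12, W21, W22, LinearMap.add_apply, LinearMap.sub_apply, LinearMap.neg_apply,
    LinearMap.smul_apply, eta_vac hD] at h
  have g := fun p => DFunLike.congr_fun h p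
  have g0 := g (0, {0})
  have g1 := g (0, {1})
  have g2 := g (0, {2})
  have g3 := g (0, {3})
  simp [bv, Finsupp.single_apply] at g0 g1 g2 g3
  have k0 : a - d = 0 := smulI (by rw [← g0]; module)
  have k2 : b + c = 0 := smulI (by rw [← g2]; module)
  refine ⟨?_, ?_, ?_, ?_⟩
  · linear_combination (norm := module) (2 : ℂ)⁻¹ • k0 + (2 : ℂ)⁻¹ • g1
  · linear_combination (norm := module) (2 : ℂ)⁻¹ • k2 - (2 : ℂ)⁻¹ • g3
  · linear_combination (norm := module) (2 : ℂ)⁻¹ • k2 + (2 : ℂ)⁻¹ • g3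
  · linear_combination (norm := module) (2 : ℂ)⁻¹ • g1 - (2 : ℂ)⁻¹ • k0

/-- Explicit form of `U`. -/
theorem U_bv (hD : IsVerma D) (p1 p2 p3 q1 q2 q3 r : F) : U D p1 p2 p3 q1 q2 q3 r =
    bv 0 {0, 1} ((2 * I) • (p2 - q2)) + bv 0 {2, 3} ((-2 * I) • (p2 + q2))
    + bv 0 {0, 2} (p3 - p1 - q1 + q3) + bv 0 {1, 3} (p3 - p1 + q1 - q3)
    + bv 0 {0, 3} (I • (q1 + q3 - p1 - p3)) + bv 0 {1, 2} (I • (p1 + p3 + q1 + q3))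
    + bv 1 ∅ r := by
  simp only [U, W11, W12, W21, W22, LinearMap.add_apply, LinearMap.sub_apply, LinearMap.neg_apply,
    LinearMap.smul_apply, map_add, map_sub, map_neg, map_smul, eta_vac hD, eta2 hD, sub_eq_add_neg,
    bv_add, bv_smul, ← neg_one_smul ℂ (_ : F), Fin.reduceEq, Fin.reduceLT, if_true, if_false,
    reduceIte]
  match_scalars <;> ring_nf <;> (try simp only [I_sq]) <;> (try ring_nf)

theorem U_zero (hD : IsVerma D) {p1 p2 p3 q1 q2 q3 r : F} (h : U D p1 p2 p3 q1 q2 q3 r = 0) :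
    p1 = 0 ∧ p2 = 0 ∧ p3 = 0 ∧ q1 = 0 ∧ q2 = 0 ∧ q3 = 0 ∧ r = 0 := by
  rw [U_bv hD] at h
  have g := fun p => DFunLike.congr_fun h p
  have d1 : ({0, 1} : Idx) ≠ {2, 3} ∧ ({0, 1} : Idx) ≠ {0, 2} ∧ ({0, 1} : Idx) ≠ {1, 3} ∧
    ({0, 1} : Idx) ≠ {0, 3} ∧ ({0, 1} : Idx) ≠ {1, 2} := by decide
  have d2 : ({2, 3} : Idx) ≠ {0, 2} ∧ ({2, 3} : Idx) ≠ {1, 3} ∧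
    ({2, 3} : Idx) ≠ {0, 3} ∧ ({2, 3} : Idx) ≠ {1, 2} := by decide
  have d3 : ({0, 2} : Idx) ≠ {1, 3} ∧ ({0, 2} : Idx) ≠ {0, 3} ∧ ({0, 2} : Idx) ≠ {1, 2} := by
    decide
  have d4 : ({1, 3} : Idx) ≠ {0, 3} ∧ ({1, 3} : Idx) ≠ {1, 2} ∧ ({0, 3} : Idx) ≠ {1, 2} := by
    decide
  have g1 := g (0, {0, 1})
  have g2 := g (0, {2, 3})
  have g3 := g (0, {0, 2})
  have g4 := g (0, {1, 3})
  have g5 := g (0, {0, 3})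
  have g6 := g (0, {1, 2})
  have g7 := g (1, ∅)
  simp [bv, Finsupp.single_apply, d1, d2, d3, d4, d1.1.symm, d1.2.1.symm, d1.2.2.1.symm,
    d1.2.2.2.1.symm, d1.2.2.2.2.symm, d2.1.symm, d2.2.1.symm, d2.2.2.1.symm, d2.2.2.2.symm,
    d3.1.symm, d3.2.1.symm, d3.2.2.symm, d4.1.symm, d4.2.1.symm, d4.2.2.symm]
    at g1 g2 g3 g4 g5 g6 g7
  have k2 : p2 + q2 = 0 := smulI (by
    have : (-2 : ℂ) • I • (p2 + q2) = 0 := by rw [← g2]; module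
    exact (smul_eq_zero.mp this).resolve_left (by norm_num))
  have k6 : p1 + p3 + q1 + q3 = 0 := smulI (by rw [← g6]; module)
  refine ⟨?_, ?_, ?_, ?_, ?_, ?_, g7⟩
  · linear_combination (norm := module) (4 : ℂ)⁻¹ • k6 - (4 : ℂ)⁻¹ • g3 - (4 : ℂ)⁻¹ • g4 - (4 : ℂ)⁻¹ • g5
  · linear_combination (norm := module) (2 : ℂ)⁻¹ • g1 + (2 : ℂ)⁻¹ • k2
  · linear_combination (norm := module) (4 : ℂ)⁻¹ • k6 + (4 : ℂ)⁻¹ • g3 + (4 : ℂ)⁻¹ • g4 - (4 : ℂ)⁻¹ • g5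
  · linear_combination (norm := module) (4 : ℂ)⁻¹ • k6 - (4 : ℂ)⁻¹ • g3 + (4 : ℂ)⁻¹ • g4 + (4 : ℂ)⁻¹ • g5
  · linear_combination (norm := module) (2 : ℂ)⁻¹ • k2 - (2 : ℂ)⁻¹ • g1
  · linear_combination (norm := module) (4 : ℂ)⁻¹ • k6 + (4 : ℂ)⁻¹ • g3 - (4 : ℂ)⁻¹ • g4 + (4 : ℂ)⁻¹ • g5

theorem exists_U (hD : IsVerma D) {u : VInd F} (h : HomogDeg u 2) :
    ∃ p1 p2 p3 q1 q2 q3 r, u = U D p1 p2 p3 q1 q2 q3 r := by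
  have e : u = bv 0 {0, 1} (u (0, {0, 1})) + bv 0 {2, 3} (u (0, {2, 3}))
    + bv 0 {0, 2} (u (0, {0, 2})) + bv 0 {1, 3} (u (0, {1, 3}))
    + bv 0 {0, 3} (u (0, {0, 3})) + bv 0 {1, 2} (u (0, {1, 2})) + bv 1 ∅ (u (1, ∅)) := by
    have hc : ∀ L : Idx, L.card = 2 → (L = {0, 1} ∨ L = {2, 3} ∨ L = {0, 2} ∨ L = {1, 3} ∨
      L = {0, 3} ∨ L = {1, 2}) := by decide
    have hs : u.support ⊆ {((0 : ℕ), ({0, 1} : Idx)), (0, {2, 3}), (0, {0, 2}), (0, {1, 3}),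
        (0, {0, 3}), (0, {1, 2}), (1, ∅)} := by
      intro p hp
      have := h p hp
      obtain ⟨k, L⟩ := p
      simp only at this
      have hk : k = 0 ∨ k = 1 := by omega
      rcases hk with rfl | rfl
      · rcases hc L (by omega) with rfl | rfl | rfl | rfl | rfl | rfl <;> decide
      · have : L = ∅ := Finset.card_eq_zero.mp (by omega)
        subst this
        decide
    have hsum : u.sum Finsupp.single = u := Finsupp.sum_single u
    rw [Finsupp.sum_of_support_subset u hs _ (by simp)] at hsum
    rw [Finset.sum_insert (by decide), Finset.sum_insert (by decide), Finset.sum_insert (by decide),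
      Finset.sum_insert (by decide), Finset.sum_insert (by decide), Finset.sum_insert (by decide),
      Finset.sum_singleton] at hsum
    unfold bv
    rw [eq_comm]
    simp only [add_assoc]
    exact hsum
  generalize u (0, {0, 1}) = v01 at e
  generalize u (0, {2, 3}) = v23 at e
  generalize u (0, {0, 2}) = v02 at e
  generalize u (0, {1, 3}) = v13 at e
  generalize u (0, {0, 3}) = v03 at e
  generalize u (0, {1, 2}) = v12 at e
  refine ⟨(-I / 4) • v12 + (I / 4) • v03 - (4 : ℂ)⁻¹ • v13 - (4 : ℂ)⁻¹ • v02,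
    (-I / 4) • v01 + (I / 4) • v23,
    (-I / 4) • v12 + (I / 4) • v03 + (4 : ℂ)⁻¹ • v13 + (4 : ℂ)⁻¹ • v02,
    (-I / 4) • v12 - (I / 4) • v03 + (4 : ℂ)⁻¹ • v13 - (4 : ℂ)⁻¹ • v02,
    (I / 4) • v01 + (I / 4) • v23,
    (-I / 4) • v12 - (I / 4) • v03 - (4 : ℂ)⁻¹ • v13 + (4 : ℂ)⁻¹ • v02, u (1, ∅), ?_⟩
  rw [U_bv hD]
  refine e.trans ?_
  congr 1
  congr 1
  congr 1
  congr 1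
  congr 1
  congr 1
  all_goals
    congr 1
    match_scalars <;> ring_nf <;> (try simp only [I_sq]) <;> (try ring_nf)

theorem homog_add {u v : VInd F} {d : ℕ} (hu : HomogDeg u d) (hv : HomogDeg v d) :
    HomogDeg (u + v) d := by
  intro p hp
  rcases Finset.mem_union.mp (Finsupp.support_add hp) with h | h
  · exact hu p h
  · exact hv p h

theorem homog_bv {k : ℕ} {L : Idx} {d : ℕ} (h : 2 * k + L.card = d) (v : F) :
    HomogDeg (bv k L v) d := by
  intro p hp
  have := Finset.mem_singleton.mp (Finsupp.support_single_subset hp)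
  subst this
  exact h

theorem homog_U (hD : IsVerma D) (p1 p2 p3 q1 q2 q3 r : F) :
    HomogDeg (U D p1 p2 p3 q1 q2 q3 r) 2 := by
  rw [U_bv hD]
  repeat' apply homog_add
  all_goals exact homog_bv (by decide) _

end Coord
end Sing2

namespace Sing2

section Singular

open Complex

variable {F : Type*} [AddCommGroup F] [Module ℂ F] {D : VermaData F}

/-- All basis elements of degree at least `d - 2` kill `x`. -/
def Kills (D : VermaData F) (d : ℕ) (x : VInd F) : Prop :=
  ∀ (m : ℕ) (J : Idx), d ≤ 2 * m + J.card → D.act m J x = 0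

theorem Kills.add {d : ℕ} {x y : VInd F} (hx : Kills D d x) (hy : Kills D d y) :
    Kills D d (x + y) := by
  intro m J h
  rw [map_add, hx m J h, hy m J h, add_zero]

theorem Kills.smul {d : ℕ} {x : VInd F} (c : ℂ) (hx : Kills D d x) : Kills D d (c • x) := by
  intro m J h
  rw [map_smul, hx m J h, smul_zero]

theorem Kills.neg {d : ℕ} {x : VInd F} (hx : Kills D d x) : Kills D d (-x) := by
  intro m J h
  rw [map_neg, hx m J h, neg_zero]

theorem Kills.sub {d : ℕ} {x y : VInd F} (hx : Kills D d x) (hy : Kills D d y) :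
    Kills D d (x - y) := by
  rw [sub_eq_add_neg]
  exact hx.add hy.neg

theorem Kills.eta (hD : IsVerma D) {d : ℕ} (hd : 3 ≤ d) {x : VInd F} (hx : Kills D d x)
    (j : Fin 4) : Kills D (d + 1) (D.act 0 {j} x) := by
  intro m J h
  have hc : ∀ l, l ≠ j → cf2 J {j} l = 0 := by
    intro l hl
    simp [cf2, hl]
  rw [comm hD (cf1 m J 0 {j}) (cf2 J {j} j) (psiZ m J 0 {j}) ((-1) ^ (J.card * ({j} : Idx).card))
    j (J ∪ {j}) (J.erase j ∪ ({j} : Idx).erase j) ⟨rfl, Or.inr rfl, hc, rfl, Or.inr rfl, rfl, rfl⟩]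
  have h1 : D.act m J x = 0 := hx m J (by omega)
  have h2 : (cf1 m J 0 {j} : ℂ) • D.act (m + 0 - 1) (J ∪ {j}) x = 0 := by
    by_cases hm : m = 0
    · subst hm
      simp [cf1]
    by_cases hj : j ∈ J
    · simp [cf1, hj]
    · rw [hx, smul_zero]
      rw [Finset.card_union_of_disjoint (by simpa using hj), Finset.card_singleton]
      omega
  have h3 : (cf2 J {j} j : ℂ) • D.act (m + 0) (J.erase j ∪ ({j} : Idx).erase j) x = 0 := by
    by_cases hj : j ∈ J
    · rw [hx, smul_zero]
      have e : J.erase j ∪ ({j} : Idx).erase j = J.erase j := by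
        ext; simp
      rw [e, Finset.card_erase_of_mem hj]
      omega
    · simp [cf2, hj]
  have h4 : psiZ m J 0 {j} = 0 := by
    by_cases hm : m = 0
    · subst hm
      have : ∀ (J : Idx) (j : Fin 4), 4 ≤ J.card → psiZ 0 J 0 {j} = 0 := by decide
      exact this J j (by omega)
    · simp [psiZ, hm]
  rw [h1, h2, h3, h4]
  simp

theorem Kills.W (hD : IsVerma D) {d : ℕ} (hd : 3 ≤ d) {x : VInd F} (hx : Kills D d x) :
    Kills D (d + 1) (W11 D x) ∧ Kills D (d + 1) (W22 D x) ∧ Kills D (d + 1) (W12 D x) ∧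
    Kills D (d + 1) (W21 D x) := by
  have h := hx.eta hD hd
  exact ⟨(h 1).add ((h 0).smul I), (h 1).sub ((h 0).smul I), (h 3).neg.add ((h 2).smul I),
    (h 3).add ((h 2).smul I)⟩

theorem kills_vac (hD : IsVerma D) (v : F) : Kills D 3 (vac v) :=
  fun m J h => pos_vac hD m J h v

theorem kills_U (hD : IsVerma D) (p1 p2 p3 q1 q2 q3 r : F) :
    Kills D 5 (U D p1 p2 p3 q1 q2 q3 r) := by
  have h3 : (3 : ℕ) ≤ 3 := le_refl _
  have h4 : (3 : ℕ) ≤ 3 + 1 := by norm_num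
  have k := fun v : F => (kills_vac hD v).W hD h3
  have k11 := fun v : F => ((k v).1).W hD h4
  have k22 := fun v : F => ((k v).2.1).W hD h4
  have k12 := fun v : F => ((k v).2.2.1).W hD h4
  have k21 := fun v : F => ((k v).2.2.2).W hD h4
  exact (((((((k12 p1).1).add (((k22 p2).1).add ((k12 p2).2.2.2))).add ((k21 p3).2.1)).add
    ((k21 q1).1)).add (((k11 q2).2.1).add ((k12 q2).2.2.2))).add ((k12 q3).2.1)).add
      ((((k22 r).1).add ((k11 r).2.1)).smul _)

/-- A family rotating as a vector and whose lowest member kills a highest weight vector kills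
that vector. -/
theorem rot_all {g : Fin 4 → VInd F →ₗ[ℂ] VInd F}
    (hg : ∀ i j : Fin 4, i < j → ∀ (k : Fin 4) (x : VInd F),
      D.act 0 {i, j} (g k x) = g k (D.act 0 {i, j} x)
      + (if k = i then g j x else 0) - (if k = j then g i x else 0))
    {u : VInd F} (hx : Ex D u = 0) (hy : Ey D u = 0) (h : g 1 u - I • g 0 u = 0) (k : Fin 4) :
    g k u = 0 := by
  have e1 : ∀ x, Ex D (g 1 x - I • g 0 x) = g 1 (Ex D x) - I • g 0 (Ex D x)
      + (-g 3 x + I • g 2 x) ∧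
      Ey D (g 1 x - I • g 0 x) = g 1 (Ey D x) - I • g 0 (Ey D x) + (g 3 x + I • g 2 x) ∧
      Ex D (g 3 x + I • g 2 x) = g 3 (Ex D x) + I • g 2 (Ex D x) + (g 1 x + I • g 0 x) := by
    intro x
    refine ⟨?_, ?_, ?_⟩ <;>
    · simp only [Ex, Ey, LinearMap.smul_apply, LinearMap.add_apply,
        LinearMap.sub_apply, LinearMap.neg_apply, map_add, map_sub, map_neg, map_smul,
        hg 0 2 (by decide), hg 0 3 (by decide), hg 1 2 (by decide), hg 1 3 (by decide)]
      simp only [Fin.reduceEq, if_true, if_false, reduceIte]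
      match_scalars <;> ring_nf <;> (try simp only [I_sq]) <;> (try ring_nf)
  obtain ⟨a1, a2, a3⟩ := e1 u
  rw [h, hx, map_zero, map_zero, map_zero, smul_zero, sub_zero, zero_add] at a1
  rw [h, hy, map_zero, map_zero, map_zero, smul_zero, sub_zero, zero_add] at a2
  rw [← a2, hx, map_zero, map_zero, map_zero, smul_zero, add_zero, zero_add] at a3
  have k3 : g 3 u = 0 := by
    linear_combination (norm := module) (2 : ℂ)⁻¹ • a1 - (2 : ℂ)⁻¹ • a2
  have k2 : g 2 u = 0 := smulI (by
    linear_combination (norm := module) -(2 : ℂ)⁻¹ • a1 - (2 : ℂ)⁻¹ • a2)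
  have k1 : g 1 u = 0 := by
    linear_combination (norm := module) (2 : ℂ)⁻¹ • h - (2 : ℂ)⁻¹ • a3
  have k0 : g 0 u = 0 := smulI (by
    linear_combination (norm := module) -(2 : ℂ)⁻¹ • h - (2 : ℂ)⁻¹ • a3)
  fin_cases k
  · exact k0
  · exact k1
  · exact k2
  · exact k3

theorem isHW_iff (u : VInd F) : IsHW D u ↔ Ex D u = 0 ∧ Ey D u = 0 := by
  unfold IsHW
  simp only [Ex, Ey, LinearMap.smul_apply, LinearMap.add_apply,
        LinearMap.sub_apply, LinearMap.neg_apply]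
  constructor
  · rintro ⟨h1, h2⟩
    constructor
    · linear_combination (norm := module) (2 : ℂ)⁻¹ • h1 + (2 : ℂ)⁻¹ • h2
    · linear_combination (norm := module) (2 : ℂ)⁻¹ • h1 - (2 : ℂ)⁻¹ • h2
  · rintro ⟨h1, h2⟩
    constructor
    · linear_combination (norm := module) h1 + h2
    · linear_combination (norm := module) h1 - h2

theorem singular_of (hD : IsVerma D) {u : VInd F} (hk : Kills D 5 u) (hx : Ex D u = 0)
    (hy : Ey D u = 0) (hX : Xo D u = 0) (hY : Yo D u = 0) :
    ∀ (m : ℕ) (J : Idx), 2 < 2 * m + J.card → D.act m J u = 0 := by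
  have t1 : ∀ k, D.act 1 {k} u = 0 :=
    rot_all (g := fun k => D.act 1 {k}) (fun i j hij k x => comm_xi hD 1 hij k x) hx hy hX
  have s1 : ∀ k, D.act 0 {k}ᶜ u = 0 := by
    intro k
    have h := rot_all (g := fun k => star D k) (fun i j hij k x => comm_star hD hij k x) hx hy hY k
    have hd : ∀ k : Fin 4, dsign k univ ≠ 0 := by decide
    have h' : (dsign k univ : ℂ) • D.act 0 {k}ᶜ u = 0 := h
    exact (smul_eq_zero.mp h').resolve_left (by exact_mod_cast hd k)
  have q1 : D.act 2 ∅ u = 0 := by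
    have := comm hD (m := 1) (I := {0}) (n := 1) (J := {0}) 0 (-1) 0 (-1) 0 ∅ ∅ (by decide) u
    rw [t1, map_zero] at this
    simpa using this
  have q2 : D.act 0 univ u = 0 := by
    have := comm hD (m := 1) (I := {0}) (n := 0) (J := {0}ᶜ) 1 0 0 (-1) 0 univ ∅ (by decide) u
    rw [t1, s1, map_zero, map_zero] at this
    simpa using this.symm
  have q3 : ∀ k l : Fin 4, k ≠ l → D.act 1 {k, l}ᶜ u = 0 := by
    intro k l hkl
    have hh : ∀ k l : Fin 4, k ≠ l → (cf1 1 {k} 0 {l}ᶜ = 0 ∧ ((0 : ℤ) = 0 ∨ ({k} : Idx) ∪ {l}ᶜ = ∅) ∧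
      (∀ j, j ≠ k → cf2 {k} {l}ᶜ j = 0) ∧
      cf2 {k} {l}ᶜ k = cf2 {k} {l}ᶜ k ∧ (cf2 {k} {l}ᶜ k = 0 ∨
        ({k} : Idx).erase k ∪ ({l}ᶜ : Idx).erase k = {k, l}ᶜ) ∧ psiZ 1 {k} 0 {l}ᶜ = 0 ∧
      (-1) ^ (({k} : Idx).card * ({l}ᶜ : Idx).card) = (-1 : ℤ)) ∧ cf2 {k} {l}ᶜ k ≠ 0 := by decide
    have := comm hD _ _ _ _ _ _ _ (hh k l hkl).1 u
    rw [t1, s1, map_zero, map_zero] at this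
    have h2 := (hh k l hkl).2
    simpa [h2] using this.symm
  intro m J h
  by_cases h5 : 5 ≤ 2 * m + J.card
  · exact hk m J h5
  have c3 : ∀ J : Idx, J.card = 3 → ∃ k, J = {k}ᶜ := by decide
  have c2 : ∀ J : Idx, J.card = 2 → ∃ k l, k ≠ l ∧ J = {k, l}ᶜ := by decide
  have hm : m = 0 ∨ m = 1 ∨ m = 2 := by omega
  rcases hm with rfl | rfl | rfl
  · rcases (show J.card = 3 ∨ J.card = 4 by omega) with h | h
    · obtain ⟨k, rfl⟩ := c3 J h
      exact s1 k
    · have : J = univ := (Finset.card_eq_iff_eq_univ J).mp (by simpa using h)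
      subst this
      exact q2
  · rcases (show J.card = 1 ∨ J.card = 2 by omega) with h | h
    · obtain ⟨k, rfl⟩ := Finset.card_eq_one.mp h
      exact t1 k
    · obtain ⟨k, l, hkl, rfl⟩ := c2 J h
      exact q3 k l hkl
  · have : J = ∅ := Finset.card_eq_zero.mp (by omega)
    subst this
    exact q1

theorem XY_of_singular {u : VInd F}
    (h : ∀ (m : ℕ) (J : Idx), 2 < 2 * m + J.card → D.act m J u = 0) :
    Xo D u = 0 ∧ Yo D u = 0 := by
  constructor
  · simp only [Xo, LinearMap.smul_apply, LinearMap.sub_apply]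
    rw [h 1 {1} (by decide), h 1 {0} (by decide)]
    simp
  · simp only [Yo, star, LinearMap.smul_apply, LinearMap.sub_apply]
    rw [h 0 {1}ᶜ (by decide), h 0 {0}ᶜ (by decide)]
    simp

end Singular
end Sing2

namespace Sing2

set_option linter.unusedSimpArgs false
set_option linter.unusedTactic false
set_option linter.unreachableTactic false
set_option linter.unnecessarySeqFocus false

section Lie

open Complex

variable {F : Type*} [AddCommGroup F] [Module ℂ F] {D : VermaData F}

theorem vac_inj {v w : F} (h : (vac v : VInd F) = vac w) : v = w :=
  Finsupp.single_injective _ h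

theorem so4 (hD : IsVerma D) {i j k l a b : Fin 4} (s : ℤ) (c : Fin 4)
    (h : (i < j ∧ k < l ∧ a < b) ∧ cf1 0 {i, j} 0 {k, l} = 0 ∧
      ((0 : ℤ) = 0 ∨ ({i, j} : Idx) ∪ {k, l} = ∅) ∧
      (∀ x, x ≠ c → cf2 {i, j} {k, l} x = 0) ∧ cf2 {i, j} {k, l} c = s ∧
      (s = 0 ∨ ({i, j} : Idx).erase c ∪ ({k, l} : Idx).erase c = {a, b}) ∧
      psiZ 0 {i, j} 0 {k, l} = 0 ∧
      (-1) ^ (({i, j} : Idx).card * ({k, l} : Idx).card) = (1 : ℤ)) (v : F) :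
    D.ρξ i j (D.ρξ k l v) = D.ρξ k l (D.ρξ i j v) + (s : ℂ) • D.ρξ a b v := by
  have := comm hD _ _ _ _ _ _ _ h.2 (vac v)
  rw [xi_vac hD h.1.1, xi_vac hD h.1.2.1, xi_vac hD h.1.1, xi_vac hD h.1.2.1] at this
  apply vac_inj
  rw [this, map_add, map_smul, xi_vac hD h.1.2.2]
  simp

theorem t_xi (hD : IsVerma D) {i j : Fin 4} (hij : i < j) (v : F) :
    D.ρt (D.ρξ i j v) = D.ρξ i j (D.ρt v) := by
  have h : ∀ i j : Fin 4, i < j → cf1 1 ∅ 0 {i, j} = 0 ∧ ((0 : ℤ) = 0 ∨ (∅ : Idx) ∪ {i, j} = ∅) ∧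
    (∀ x, x ≠ 0 → cf2 ∅ {i, j} x = 0) ∧ cf2 ∅ {i, j} 0 = 0 ∧ ((0 : ℤ) = 0 ∨
    (∅ : Idx).erase 0 ∪ ({i, j} : Idx).erase 0 = ∅) ∧ psiZ 1 ∅ 0 {i, j} = 0 ∧
    (-1) ^ ((∅ : Idx).card * ({i, j} : Idx).card) = (1 : ℤ) := by decide
  have := comm hD _ _ _ _ _ _ _ (h i j hij) (vac v)
  rw [xi_vac hD hij, T_vac hD, T_vac hD, xi_vac hD hij] at this
  apply vac_inj
  rw [this]
  simp

theorem C_eq0 (hD : IsVerma D) (v : F) :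
    (vac (D.ρC v) : VInd F) = -star D 0 (D.act 0 {0} (vac v)) := by
  have h := comm_star0 hD 0 (vac v)
  have h0 : star D 0 (vac v) = 0 := by
    simp only [star, LinearMap.smul_apply]
    rw [pos_vac hD 0 {0}ᶜ (by decide), smul_zero]
  rw [h, h0, ← C_vac]
  simp

theorem C_eq1 (hD : IsVerma D) (v : F) :
    (vac (D.ρC v) : VInd F) = -star D 1 (D.act 0 {1} (vac v)) := by
  have h := comm_star1 hD 1 (vac v)
  have h0 : star D 1 (vac v) = 0 := by
    simp only [star, LinearMap.smul_apply]
    rw [pos_vac hD 0 {1}ᶜ (by decide), smul_zero]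
  rw [h, h0, ← C_vac]
  simp

theorem C_xi0 (hD : IsVerma D) {i j : Fin 4} (hi : 0 ≠ i) (hj : 0 ≠ j) (hij : i < j) (v : F) :
    D.ρC (D.ρξ i j v) = D.ρξ i j (D.ρC v) := by
  apply vac_inj
  rw [C_eq0 hD, ← xi_vac hD hij, ← xi_vac hD hij, C_eq0 hD, map_neg, comm_star hD hij,
    comm_xi hD 0 hij]
  simp [hi, hj]

theorem C_xi1 (hD : IsVerma D) {i j : Fin 4} (hi : 1 ≠ i) (hj : 1 ≠ j) (hij : i < j) (v : F) :
    D.ρC (D.ρξ i j v) = D.ρξ i j (D.ρC v) := by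
  apply vac_inj
  rw [C_eq1 hD, ← xi_vac hD hij, ← xi_vac hD hij, C_eq1 hD, map_neg, comm_star hD hij,
    comm_xi hD 0 hij]
  simp [hi, hj]

theorem C_t (hD : IsVerma D) (v : F) : D.ρC (D.ρt v) = D.ρt (D.ρC v) := by
  apply vac_inj
  have h := fun x => comm hD (m := 1) (I := ∅) (n := 0) (J := {0}ᶜ) 1 0 0 1 0 {0}ᶜ ∅ (by decide) x
  have hs : ∀ x, D.act 1 ∅ (star D 0 x) = star D 0 (D.act 1 ∅ x) + star D 0 x := by
    intro x
    have hd : dsign 0 (univ : Idx) = 1 := by decide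
    simp only [star, LinearMap.smul_apply, map_smul, hd]
    rw [h]
    simp
  rw [C_eq0 hD, ← T_vac hD, ← T_vac hD, C_eq0 hD, map_neg, hs, comm_t hD, map_sub]
  abel

theorem all_xi (hD : IsVerma D) {p : Submodule ℂ F} {v : F}
    (up : ∀ i j : Fin 4, i < j → D.ρξ i j v ∈ p) (i j : Fin 4) : D.ρξ i j v ∈ p := by
  rcases lt_trichotomy i j with h | h | h
  · exact up i j h
  · subst h
    have h1 : D.ρξ i i v = -D.ρξ i i v := by
      conv_lhs => rw [hD.anti i i]
      rfl
    have h2 : D.ρξ i i v = 0 := by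
      linear_combination (norm := module) (2 : ℂ)⁻¹ • h1
    rw [h2]
    exact p.zero_mem
  · rw [hD.anti i j]
    exact p.neg_mem (up j i h)

theorem scalar_of (hD : IsVerma D) (hirr : IsIrred D) {f : F →ₗ[ℂ] F} {a : ℂ} {v : F} (hv : v ≠ 0)
    (hfv : f v = a • v) (ht : ∀ w, f (D.ρt w) = D.ρt (f w)) (hC : ∀ w, f (D.ρC w) = D.ρC (f w))
    (hx : ∀ i j : Fin 4, i < j → ∀ w, f (D.ρξ i j w) = D.ρξ i j (f w)) (w : F) : f w = a • w := by
  have key := hirr.2 (LinearMap.ker (f - a • LinearMap.id)) (by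
    intro w hw
    have hw' : f w = a • w := by
      simpa [sub_eq_zero] using hw
    refine ⟨?_, ?_, all_xi hD fun i j hij => ?_⟩
    · simp [sub_eq_zero, ht, hw']
    · simp [sub_eq_zero, hC, hw']
    · simp [sub_eq_zero, hx i j hij, hw'])
  have hm : v ∈ LinearMap.ker (f - a • LinearMap.id) := by simp [sub_eq_zero, hfv]
  rcases key with h | h
  · rw [h, Submodule.mem_bot] at hm
    exact absurd hm hv
  · have : w ∈ LinearMap.ker (f - a • LinearMap.id) := by rw [h]; trivial
    simpa [sub_eq_zero] using this

theorem sl2 (hD : IsVerma D) (hirr : ∀ p : Submodule ℂ F,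
    (∀ v ∈ p, ∀ i j, D.ρξ i j v ∈ p) → p = ⊥ ∨ p = ⊤) :
    Sl2Pair (exF D) (fxF D) (hxF D) (eyF D) (fyF D) (hyF D) := by
  have r0102 := fun v => so4 hD (i := 0) (j := 1) (k := 0) (l := 2) (a := 1) (b := 2) (1) 0
    (by decide) v
  have r0103 := fun v => so4 hD (i := 0) (j := 1) (k := 0) (l := 3) (a := 1) (b := 3) (1) 0
    (by decide) v
  have r0112 := fun v => so4 hD (i := 0) (j := 1) (k := 1) (l := 2) (a := 0) (b := 2) (-1) 1
    (by decide) v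
  have r0113 := fun v => so4 hD (i := 0) (j := 1) (k := 1) (l := 3) (a := 0) (b := 3) (-1) 1
    (by decide) v
  have r0123 := fun v => so4 hD (i := 0) (j := 1) (k := 2) (l := 3) (a := 0) (b := 1) (0) 0
    (by decide) v
  have r0203 := fun v => so4 hD (i := 0) (j := 2) (k := 0) (l := 3) (a := 2) (b := 3) (1) 0
    (by decide) v
  have r0212 := fun v => so4 hD (i := 0) (j := 2) (k := 1) (l := 2) (a := 0) (b := 1) (1) 2
    (by decide) v
  have r0213 := fun v => so4 hD (i := 0) (j := 2) (k := 1) (l := 3) (a := 0) (b := 1) (0) 0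
    (by decide) v
  have r0223 := fun v => so4 hD (i := 0) (j := 2) (k := 2) (l := 3) (a := 0) (b := 3) (-1) 2
    (by decide) v
  have r0312 := fun v => so4 hD (i := 0) (j := 3) (k := 1) (l := 2) (a := 0) (b := 1) (0) 0
    (by decide) v
  have r0313 := fun v => so4 hD (i := 0) (j := 3) (k := 1) (l := 3) (a := 0) (b := 1) (1) 3
    (by decide) v
  have r0323 := fun v => so4 hD (i := 0) (j := 3) (k := 2) (l := 3) (a := 0) (b := 2) (1) 3
    (by decide) v
  have r1213 := fun v => so4 hD (i := 1) (j := 2) (k := 1) (l := 3) (a := 2) (b := 3) (1) 1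
    (by decide) v
  have r1223 := fun v => so4 hD (i := 1) (j := 2) (k := 2) (l := 3) (a := 1) (b := 3) (-1) 2
    (by decide) v
  have r1323 := fun v => so4 hD (i := 1) (j := 3) (k := 2) (l := 3) (a := 1) (b := 2) (1) 3
    (by decide) v
  have hxef : ∀ v, exF D (fxF D v) = fxF D (exF D v) + hxF D v := by
    intro v
    simp only [exF, eyF, e1F, e2F, fxF, fyF, hxF, hyF, LinearMap.smul_apply, LinearMap.add_apply,
      LinearMap.sub_apply, LinearMap.neg_apply, map_add, map_sub, map_neg, map_smul,
        r0102, r0103, r0112, r0113, r0123, r0203, r0212, r0213, r0223, r0312, r0313, r0323, r1213, r1223, r1323]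
    match_scalars <;> push_cast <;> ring_nf <;> (try simp only [I_sq]) <;> (try ring_nf)
  have hyef : ∀ v, eyF D (fyF D v) = fyF D (eyF D v) + hyF D v := by
    intro v
    simp only [exF, eyF, e1F, e2F, fxF, fyF, hxF, hyF, LinearMap.smul_apply, LinearMap.add_apply,
      LinearMap.sub_apply, LinearMap.neg_apply, map_add, map_sub, map_neg, map_smul,
        r0102, r0103, r0112, r0113, r0123, r0203, r0212, r0213, r0223, r0312, r0313, r0323, r1213, r1223, r1323]
    match_scalars <;> push_cast <;> ring_nf <;> (try simp only [I_sq]) <;> (try ring_nf)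
  refine ⟨hxef, ?_, ?_, hyef, ?_, ?_, ?_, ?_, ?_, ?_, ?_⟩
  all_goals try
    · intro v
      simp only [exF, eyF, e1F, e2F, fxF, fyF, hxF, hyF, LinearMap.smul_apply, LinearMap.add_apply,
        LinearMap.sub_apply, LinearMap.neg_apply, map_add, map_sub, map_neg, map_smul,
        r0102, r0103, r0112, r0113, r0123, r0203, r0212, r0213, r0223, r0312, r0313, r0323, r1213, r1223, r1323]
      match_scalars <;> push_cast <;> ring_nf <;> (try simp only [I_sq]) <;> (try ring_nf)
  intro p hp
  apply hirr p
  intro v hv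
  obtain ⟨h1, h2, h3, h4⟩ := hp v hv
  have h5 : hxF D v ∈ p := by
    have : hxF D v = exF D (fxF D v) - fxF D (exF D v) := by rw [hxef]; abel
    rw [this]
    exact p.sub_mem (hp _ h2).1 (hp _ h1).2.1
  have h6 : hyF D v ∈ p := by
    have : hyF D v = eyF D (fyF D v) - fyF D (eyF D v) := by rw [hyef]; abel
    rw [this]
    exact p.sub_mem (hp _ h4).2.2.1 (hp _ h3).2.2.2
  have k01 : D.ρξ 0 1 v ∈ p := by
    have : D.ρξ 0 1 v = (I / 2) • (hxF D v + hyF D v) := by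
      simp only [exF, eyF, e1F, e2F, fxF, fyF, hxF, hyF, LinearMap.smul_apply, LinearMap.add_apply,
        LinearMap.sub_apply, LinearMap.neg_apply, map_add, map_sub, map_neg, map_smul]
      match_scalars <;> push_cast <;> ring_nf <;> (try simp only [I_sq]) <;> (try ring_nf)
    rw [this]
    exact p.smul_mem _ (p.add_mem h5 h6)
  have k23 : D.ρξ 2 3 v ∈ p := by
    have : D.ρξ 2 3 v = (-I / 2) • (hxF D v - hyF D v) := by
      simp only [exF, eyF, e1F, e2F, fxF, fyF, hxF, hyF, LinearMap.smul_apply, LinearMap.add_apply,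
        LinearMap.sub_apply, LinearMap.neg_apply, map_add, map_sub, map_neg, map_smul]
      match_scalars <;> push_cast <;> ring_nf <;> (try simp only [I_sq]) <;> (try ring_nf)
    rw [this]
    exact p.smul_mem _ (p.sub_mem h5 h6)
  have k12 : D.ρξ 1 2 v ∈ p := by
    have : D.ρξ 1 2 v = (-I / 2) • (exF D v + eyF D v + (fxF D v + fyF D v)) := by
      simp only [exF, eyF, e1F, e2F, fxF, fyF, hxF, hyF, LinearMap.smul_apply, LinearMap.add_apply,
        LinearMap.sub_apply, LinearMap.neg_apply, map_add, map_sub, map_neg, map_smul]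
      match_scalars <;> push_cast <;> ring_nf <;> (try simp only [I_sq]) <;> (try ring_nf)
    rw [this]
    exact p.smul_mem _ (p.add_mem (p.add_mem h1 h3) (p.add_mem h2 h4))
  have k02 : D.ρξ 0 2 v ∈ p := by
    have : D.ρξ 0 2 v = (2 : ℂ)⁻¹ • (fxF D v + fyF D v - (exF D v + eyF D v)) := by
      simp only [exF, eyF, e1F, e2F, fxF, fyF, hxF, hyF, LinearMap.smul_apply, LinearMap.add_apply,
        LinearMap.sub_apply, LinearMap.neg_apply, map_add, map_sub, map_neg, map_smul]
      match_scalars <;> push_cast <;> ring_nf <;> (try simp only [I_sq]) <;> (try ring_nf)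
    rw [this]
    exact p.smul_mem _ (p.sub_mem (p.add_mem h2 h4) (p.add_mem h1 h3))
  have k13 : D.ρξ 1 3 v ∈ p := by
    have : D.ρξ 1 3 v = (2 : ℂ)⁻¹ • (fxF D v - fyF D v - (exF D v - eyF D v)) := by
      simp only [exF, eyF, e1F, e2F, fxF, fyF, hxF, hyF, LinearMap.smul_apply, LinearMap.add_apply,
        LinearMap.sub_apply, LinearMap.neg_apply, map_add, map_sub, map_neg, map_smul]
      match_scalars <;> push_cast <;> ring_nf <;> (try simp only [I_sq]) <;> (try ring_nf)
    rw [this]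
    exact p.smul_mem _ (p.sub_mem (p.sub_mem h2 h4) (p.sub_mem h1 h3))
  have k03 : D.ρξ 0 3 v ∈ p := by
    have : D.ρξ 0 3 v = (I / 2) • (fxF D v - fyF D v + (exF D v - eyF D v)) := by
      simp only [exF, eyF, e1F, e2F, fxF, fyF, hxF, hyF, LinearMap.smul_apply, LinearMap.add_apply,
        LinearMap.sub_apply, LinearMap.neg_apply, map_add, map_sub, map_neg, map_smul]
      match_scalars <;> push_cast <;> ring_nf <;> (try simp only [I_sq]) <;> (try ring_nf)
    rw [this]
    exact p.smul_mem _ (p.add_mem (p.sub_mem h2 h4) (p.sub_mem h1 h3))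
  have up : ∀ i j : Fin 4, i < j → D.ρξ i j v ∈ p := by
    intro i j hij
    fin_cases i <;> fin_cases j <;> first | assumption | exact absurd hij (by decide)
  exact all_xi hD up


theorem scalars (hD : IsVerma D) (hirr : IsIrred D) {wa wb wt wc : ℂ} {v : F}
    (h : IsHWvec D (wa, wb, wt, wc) v) :
    (∀ w, D.ρt w = wt • w) ∧ (∀ w, D.ρC w = wc • w) := by
  obtain ⟨hv, -, -, -, -, h1, h2⟩ := h
  have c01 : ∀ w, D.ρC (D.ρξ 0 1 w) = D.ρξ 0 1 (D.ρC w) := by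
    intro w
    have r := fun v => so4 hD (i := 0) (j := 2) (k := 1) (l := 2) (a := 0) (b := 1) (1) 2
      (by decide) v
    have a1 := C_xi1 hD (i := 0) (j := 2) (by decide) (by decide) (by decide)
    have a2 := C_xi0 hD (i := 1) (j := 2) (by decide) (by decide) (by decide)
    have e : ∀ v, D.ρξ 0 1 v = D.ρξ 0 2 (D.ρξ 1 2 v) - D.ρξ 1 2 (D.ρξ 0 2 v) := by
      intro v
      rw [r]
      simp
    rw [e, e, map_sub, a1, a2, a2, a1]
  have cc : ∀ i j : Fin 4, i < j → ∀ w, D.ρC (D.ρξ i j w) = D.ρξ i j (D.ρC w) := by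
    intro i j hij
    by_cases hi : 0 = i
    · subst hi
      by_cases hj : 1 = j
      · subst hj
        exact c01
      · exact C_xi1 hD (by decide) hj hij
    · exact C_xi0 hD hi (by rintro rfl; exact absurd hij (by simp)) hij
  exact ⟨scalar_of hD hirr hv h1 (fun _ => rfl) (fun w => (C_t hD w).symm)
    (fun i j hij => t_xi hD hij), scalar_of hD hirr hv h2 (C_t hD) (fun _ => rfl) cc⟩

theorem sl2_irr (hD : IsVerma D) (hirr : IsIrred D) {wa wb wt wc : ℂ} {v : F}
    (h : IsHWvec D (wa, wb, wt, wc) v) :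
    Sl2Pair (exF D) (fxF D) (hxF D) (eyF D) (fyF D) (hyF D) ∧
    Sl2Pair.HW (exF D) (hxF D) (eyF D) (hyF D) wa wb v := by
  obtain ⟨ht, hC⟩ := scalars hD hirr h
  refine ⟨sl2 hD fun p hp => hirr.2 p fun v hv => ⟨?_, ?_, hp v hv⟩, ?_⟩
  · rw [ht]; exact p.smul_mem _ hv
  · rw [hC]; exact p.smul_mem _ hv
  · obtain ⟨hv, e1, e2, h1, h2, -, -⟩ := h
    exact ⟨hv, by simp [exF, e1, e2], by simp [eyF, e1, e2], h1, h2⟩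

end Lie
end Sing2

namespace Sing2

section Final

open Complex

variable {F : Type*} [AddCommGroup F] [Module ℂ F] {D : VermaData F}

theorem homog_smul {u : VInd F} {d : ℕ} (c : ℂ) (hu : HomogDeg u d) : HomogDeg (c • u) d :=
  fun p hp => hu p (Finsupp.support_smul hp)

/-- The four operator equations characterizing highest weight singular vectors of degree 2. -/
def Good (D : VermaData F) (u : VInd F) : Prop :=
  Ex D u = 0 ∧ Ey D u = 0 ∧ Xo D u = 0 ∧ Yo D u = 0

theorem Good.smul {u : VInd F} (c : ℂ) (h : Good D u) : Good D (c • u) := by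
  obtain ⟨h1, h2, h3, h4⟩ := h
  refine ⟨?_, ?_, ?_, ?_⟩ <;> simp only [map_smul, h1, h2, h3, h4, smul_zero]

theorem good_iff (hD : IsVerma D) (u : VInd F) :
    (IsSingular D u ∧ HomogDeg u 2 ∧ IsHW D u) ↔ u ≠ 0 ∧ HomogDeg u 2 ∧ Good D u := by
  constructor
  · rintro ⟨⟨h0, h1⟩, h2, h3⟩
    obtain ⟨a, b⟩ := (isHW_iff u).mp h3
    obtain ⟨c, d⟩ := XY_of_singular h1
    exact ⟨h0, h2, a, b, c, d⟩
  · rintro ⟨h0, h1, a, b, c, d⟩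
    refine ⟨⟨h0, ?_⟩, h1, (isHW_iff u).mpr ⟨a, b⟩⟩
    obtain ⟨p1, p2, p3, q1, q2, q3, r, rfl⟩ := exists_U hD h1
    exact singular_of hD (kills_U hD _ _ _ _ _ _ _) a b c d

theorem U_000 : U D 0 0 0 0 0 0 0 = 0 := by simp [U]

theorem V_000 : V D 0 0 0 0 = 0 := by simp [V]

variable {wa wb wt wc : ℂ} {v : F}

theorem forward [FiniteDimensional ℂ F] (hD : IsVerma D)
    (P : Sl2Pair (exF D) (fxF D) (hxF D) (eyF D) (fyF D) (hyF D))
    (H : Sl2Pair.HW (exF D) (hxF D) (eyF D) (hyF D) wa wb v)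
    (ht : ∀ w, D.ρt w = wt • w) (hC : ∀ w, D.ρC w = wc • w) (p1 p2 p3 q1 q2 q3 r : F)
    (h0 : U D p1 p2 p3 q1 q2 q3 r ≠ 0) (hg : Good D (U D p1 p2 p3 q1 q2 q3 r)) :
    ∃ c : ℂ, c ≠ 0 ∧
        ((∃ n : ℕ, wa = 0 ∧ wb = n ∧ wt = 1 - (n : ℂ) / 2 ∧ wc = -1 - (n : ℂ) / 2 ∧
            U D p1 p2 p3 q1 q2 q3 r = U D 0 0 0 (c • v) 0 0 0) ∨
         (∃ m : ℕ, wa = m ∧ wb = 0 ∧ wt = 1 - (m : ℂ) / 2 ∧ wc = 1 + (m : ℂ) / 2 ∧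
            U D p1 p2 p3 q1 q2 q3 r = U D (c • v) 0 0 0 0 0 0) ∨
         (∃ m : ℕ, 1 < m ∧ wa = m ∧ wb = 0 ∧ wt = 2 + (m : ℂ) / 2 ∧ wc = -(m : ℂ) / 2 ∧
            U D p1 p2 p3 q1 q2 q3 r =
              U D (-(c * ((m : ℂ) * ((m : ℂ) - 1))⁻¹) • fxF D (fxF D v))
                ((c * (m : ℂ)⁻¹) • fxF D v) (c • v) 0 0 0 0) ∨
         (∃ n : ℕ, 1 < n ∧ wa = 0 ∧ wb = n ∧ wt = 2 + (n : ℂ) / 2 ∧ wc = (n : ℂ) / 2 ∧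
            U D p1 p2 p3 q1 q2 q3 r =
              U D 0 0 0 (-(c * ((n : ℂ) * ((n : ℂ) - 1))⁻¹) • fyF D (fyF D v))
                (-(c * (n : ℂ)⁻¹) • fyF D v) (c • v) 0)) := by
  obtain ⟨hx, hy, hX, hY⟩ := hg
  rw [Ex_U hD] at hx
  rw [Ey_U hD] at hy
  rw [X_U hD] at hX
  rw [Y_U hD] at hY
  obtain ⟨x1, x2, x3, x4, x5, x6, x7⟩ := U_zero hD hx
  obtain ⟨y1, y2, y3, y4, y5, y6, y7⟩ := U_zero hD hy
  obtain ⟨X1, X2, X3, X4⟩ := V_zero hD hX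
  obtain ⟨Y1, Y2, Y3, Y4⟩ := V_zero hD hY
  simp only [ht] at X2 X3 X4
  simp only [hC] at Y2 Y3 Y4
  have H' : Sl2Pair.HW (eyF D) (hyF D) (exF D) (hxF D) wb wa v := ⟨H.ne, H.ey0, H.ex0, H.hyv, H.hxv⟩
  have fp1 : fyF D p1 = 0 := by
    linear_combination (norm := module) (4 : ℂ)⁻¹ • X1 + (4 : ℂ)⁻¹ • Y1
  have fq1 : fxF D q1 = 0 := by
    linear_combination (norm := module) (4 : ℂ)⁻¹ • X1 - (4 : ℂ)⁻¹ • Y1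
  have pz : p1 = 0 → p2 = 0 ∧ p3 = 0 := by
    rintro rfl
    have h2 : p2 = 0 := by simpa using x1
    subst h2
    exact ⟨rfl, by simpa using x2⟩
  have qz : q1 = 0 → q2 = 0 ∧ q3 = 0 := by
    rintro rfl
    have h2 : q2 = 0 := by simpa using y4
    subst h2
    exact ⟨rfl, by simpa using y5⟩
  have dich : (wa = 0 ∧ p1 = 0) ∨ (wb = 0 ∧ q1 = 0) := by
    by_cases hb : wb = 0
    · by_cases ha : wa = 0
      · by_cases hp : p1 = 0
        · exact Or.inl ⟨ha, hp⟩
        · right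
          refine ⟨hb, ?_⟩
          have tx := P.triv_x H ha
          have ty := P.swap.triv_x H' hb
          have thx := P.triv_hx H ha
          have thy := P.swap.triv_hx H' hb
          simp only [(tx _).1, (tx _).2, (ty _).1, (ty _).2, thx, thy] at x1 x2 y4 y5 Y2 Y3
          have hc : (2 - 2 * wc) • p1 = 0 := by
            linear_combination (norm := module) Y2
          have hc' : (2 - 2 * wc) = 0 := (smul_eq_zero.mp hc).resolve_right hp
          have hq : (-2 - 2 * wc) • q1 = 0 := by
            linear_combination (norm := module) Y3
          refine (smul_eq_zero.mp hq).resolve_left ?_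
          intro h
          have : (4 : ℂ) = 0 := by linear_combination hc' - h
          norm_num at this
      · exact Or.inr ⟨hb, P.ker_x H ha q1 x4 fq1⟩
    · have hp1 := P.swap.ker_x H' hb p1 y1 fp1
      by_cases ha : wa = 0
      · exact Or.inl ⟨ha, hp1⟩
      · exfalso
        have hq1 := P.ker_x H ha q1 x4 fq1
        obtain ⟨hp2, hp3⟩ := pz hp1
        obtain ⟨hq2, hq3⟩ := qz hq1
        subst hp1 hp2 hp3 hq1 hq2 hq3
        have hr : r = 0 := by simpa using X4
        subst hr
        exact h0 U_000
  rcases dich with ⟨ha, hp1⟩ | ⟨hb, hq1⟩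
  · obtain ⟨hp2, hp3⟩ := pz hp1
    subst hp1 hp2 hp3
    have tx := P.triv_x H ha
    have thx := P.triv_hx H ha
    simp only [thx, map_zero, smul_zero] at X2 X3 X4 Y2 Y3 Y4
    have B := P.swap.branch H' wt wc q1 q2 q3 r (fun p => (tx p).1) y6
      (by linear_combination (norm := module) y5) (by linear_combination (norm := module) y4) y7
      (by linear_combination (norm := module) X3) (by linear_combination (norm := module) Y3)
      (by linear_combination (norm := module) X4) (by linear_combination (norm := module) Y4)
    obtain ⟨hr, B⟩ := B
    subst hr
    rcases B with ⟨hq2, hq3, g, hq1, hg⟩ | ⟨g, hg, n, hn, hb, h1, h2, e3, e2, e1⟩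
    · subst hq1 hq2 hq3
      have hg0 : g ≠ 0 := by
        rintro rfl
        rw [zero_smul] at h0
        exact h0 U_000
      obtain ⟨n, hn⟩ := P.swap.exists_nat H'
      obtain ⟨k1, k2⟩ := hg hg0
      exact ⟨g, hg0, Or.inl ⟨n, ha, hn, by rw [k1, hn], by rw [k2, hn], rfl⟩⟩
    · subst e1 e2 e3
      exact ⟨g, hg, Or.inr (Or.inr (Or.inr ⟨n, hn, ha, hb, h1, h2, rfl⟩))⟩
  · obtain ⟨hq2, hq3⟩ := qz hq1
    subst hq1 hq2 hq3
    have ty := P.swap.triv_x H' hb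
    have thy := P.swap.triv_hx H' hb
    simp only [thy, map_zero, smul_zero] at X2 X3 X4 Y2 Y3 Y4
    have B := P.branch H wt (-wc) p1 (-p2) p3 r (fun p => (ty p).1) x3
      (by rw [map_neg]; linear_combination (norm := module) -x2)
      (by linear_combination (norm := module) x1) x7
      (by rw [map_neg]; linear_combination (norm := module) X2)
      (by rw [map_neg]; linear_combination (norm := module) -Y2)
      (by rw [map_neg]; linear_combination (norm := module) X4)
      (by rw [map_neg]; linear_combination (norm := module) -Y4)
    obtain ⟨hr, B⟩ := B
    subst hr
    rcases B with ⟨hq2, hq3, g, hq1, hg⟩ | ⟨g, hg, n, hn, ha, h1, h2, e3, e2, e1⟩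
    · have hp2 : p2 = 0 := neg_eq_zero.mp hq2
      subst hq1 hp2 hq3
      have hg0 : g ≠ 0 := by
        rintro rfl
        rw [zero_smul] at h0
        exact h0 U_000
      obtain ⟨n, hn⟩ := P.exists_nat H
      obtain ⟨k1, k2⟩ := hg hg0
      refine ⟨g, hg0, Or.inr (Or.inl ⟨n, hn, hb, by rw [k1, hn], ?_, rfl⟩)⟩
      rw [← hn]
      linear_combination -k2
    · have hp2 : p2 = (g * (n : ℂ)⁻¹) • fxF D v := by
        linear_combination (norm := module) -e2
      subst e1 hp2 e3
      refine ⟨g, hg, Or.inr (Or.inr (Or.inl ⟨n, hn, ha, hb, h1, ?_, rfl⟩))⟩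
      linear_combination -h2

theorem revY (hD : IsVerma D)
    (P : Sl2Pair (exF D) (fxF D) (hxF D) (eyF D) (fyF D) (hyF D))
    (H : Sl2Pair.HW (exF D) (hxF D) (eyF D) (hyF D) wa wb v)
    (ht : ∀ w, D.ρt w = wt • w) (hC : ∀ w, D.ρC w = wc • w) (ha : wa = 0) (q1 q2 q3 : F)
    (h : eyF D q3 = 0 ∧ eyF D q2 = -q3 ∧ eyF D q1 = (2 : ℂ) • q2 ∧
    (2 - 2 * wt) • q1 - hyF D q1 + (2 : ℂ) • fyF D q2 = 0 ∧
    (-2 - 2 * wc) • q1 - hyF D q1 + (2 : ℂ) • fyF D q2 = 0 ∧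
    (2 * wt - 2) • q2 + hyF D q2 + (2 : ℂ) • fyF D q3 = 0 ∧
    (2 * wc + 2) • q2 + hyF D q2 + (2 : ℂ) • fyF D q3 = 0) :
    Good D (U D 0 0 0 q1 q2 q3 0) := by
  have tx := P.triv_x H ha
  have thx := P.triv_hx H ha
  obtain ⟨h1, h2, h3, h4, h5, h6, h7⟩ := h
  refine ⟨?_, ?_, ?_, ?_⟩
  · rw [Ex_U hD]
    simp only [(tx _).1, smul_zero, add_zero, sub_zero]
    exact U_000
  · rw [Ey_U hD, h1, h2, h3]
    simp only [map_zero, sub_self, neg_add_cancel]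
    exact U_000
  · rw [X_U hD]
    simp only [ht, thx, (tx _).2]
    have e3 : (2 : ℂ) • fyF D 0 + ((2 : ℂ) • q1 - 0 - hyF D q1 - (2 : ℂ) • wt • q1)
        + (2 : ℂ) • fyF D q2 = 0 := by
      rw [map_zero]
      linear_combination (norm := module) h4
    have e4 : (2 : ℂ) • (0 : F) - 0 - hyF D 0 - (2 : ℂ) • wt • (0 : F) + (2 : ℂ) • (0 : F)
        + (0 + hyF D q2 + (2 : ℂ) • wt • q2 - (2 : ℂ) • q2) + (2 : ℂ) • fyF D q3 + 0 = 0 := by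
      rw [map_zero]
      linear_combination (norm := module) h6
    rw [e3, e4]
    simp [V]
  · rw [Y_U hD]
    simp only [hC, thx, (tx _).2]
    have e3 : (2 : ℂ) • fyF D 0 + (-(2 : ℂ) • q1 + 0 - hyF D q1 - (2 : ℂ) • wc • q1)
        + (2 : ℂ) • fyF D q2 = 0 := by
      rw [map_zero]
      linear_combination (norm := module) h5
    have e4 : (2 : ℂ) • (0 : F) + 0 - hyF D 0 - (2 : ℂ) • wc • (0 : F) - (2 : ℂ) • (0 : F)
        + ((2 : ℂ) • q2 - 0 + hyF D q2 + (2 : ℂ) • wc • q2) + (2 : ℂ) • fyF D q3 = 0 := by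
      rw [map_zero]
      linear_combination (norm := module) h7
    rw [e3, e4]
    simp [V]

theorem revX (hD : IsVerma D)
    (P : Sl2Pair (exF D) (fxF D) (hxF D) (eyF D) (fyF D) (hyF D))
    (H : Sl2Pair.HW (exF D) (hxF D) (eyF D) (hyF D) wa wb v)
    (ht : ∀ w, D.ρt w = wt • w) (hC : ∀ w, D.ρC w = wc • w) (hb : wb = 0) (p1 p2 p3 : F)
    (h : exF D p3 = 0 ∧ exF D (-p2) = -p3 ∧ exF D p1 = (2 : ℂ) • (-p2) ∧
    (2 - 2 * wt) • p1 - hxF D p1 + (2 : ℂ) • fxF D (-p2) = 0 ∧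
    (-2 - 2 * (-wc)) • p1 - hxF D p1 + (2 : ℂ) • fxF D (-p2) = 0 ∧
    (2 * wt - 2) • (-p2) + hxF D (-p2) + (2 : ℂ) • fxF D p3 = 0 ∧
    (2 * (-wc) + 2) • (-p2) + hxF D (-p2) + (2 : ℂ) • fxF D p3 = 0) :
    Good D (U D p1 p2 p3 0 0 0 0) := by
  have H' : Sl2Pair.HW (eyF D) (hyF D) (exF D) (hxF D) wb wa v := ⟨H.ne, H.ey0, H.ex0, H.hyv, H.hxv⟩
  have ty := P.swap.triv_x H' hb
  have thy := P.swap.triv_hx H' hb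
  simp only [map_neg] at h
  obtain ⟨h1, h2, h3, h4, h5, h6, h7⟩ := h
  refine ⟨?_, ?_, ?_, ?_⟩
  · rw [Ex_U hD, h1, h3, neg_injective h2]
    simp only [map_zero, sub_self, smul_neg, neg_add_cancel]
    exact U_000
  · rw [Ey_U hD]
    simp only [(ty _).1, smul_zero, add_zero, sub_zero]
    exact U_000
  · rw [X_U hD]
    simp only [ht, thy, (ty _).2]
    have e3 : (2 : ℂ) • p1 - hxF D p1 - 0 - (2 : ℂ) • wt • p1 - (2 : ℂ) • fxF D p2
        - (2 : ℂ) • fxF D 0 = 0 := by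
      rw [map_zero]
      linear_combination (norm := module) h4
    have e4 : (2 : ℂ) • p2 - hxF D p2 - 0 - (2 : ℂ) • wt • p2 + (2 : ℂ) • fxF D p3
        + (hxF D 0 + 0 + (2 : ℂ) • wt • (0 : F) - (2 : ℂ) • (0 : F)) + (2 : ℂ) • (0 : F) + 0
          = 0 := by
      rw [map_zero]
      linear_combination (norm := module) h6
    rw [e3, e4]
    simp [V]
  · rw [Y_U hD]
    simp only [hC, thy, (ty _).2]
    have e3 : (2 : ℂ) • p1 + hxF D p1 - 0 - (2 : ℂ) • wc • p1 + (2 : ℂ) • fxF D p2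
        + (2 : ℂ) • fxF D 0 = 0 := by
      rw [map_zero]
      linear_combination (norm := module) -h5
    have e4 : (2 : ℂ) • p2 + hxF D p2 - 0 - (2 : ℂ) • wc • p2 - (2 : ℂ) • fxF D p3
        + ((2 : ℂ) • (0 : F) - hxF D 0 + 0 + (2 : ℂ) • wc • (0 : F)) + (2 : ℂ) • (0 : F) = 0 := by
      rw [map_zero]
      linear_combination (norm := module) -h7
    rw [e3, e4]
    simp [V]

theorem formA (hD : IsVerma D) (c : ℂ) (v : F) :
    c • tens (cmul w11 w21) v = U D 0 0 0 (c • v) 0 0 0 := by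
  rw [(tens_W hD _ _).1, (tens_w hD _).2.2.2]
  simp [U]

theorem formB (hD : IsVerma D) (c : ℂ) (v : F) :
    c • tens (cmul w11 w12) v = U D (c • v) 0 0 0 0 0 0 := by
  rw [(tens_W hD _ _).1, (tens_w hD _).2.2.1]
  simp [U]

theorem formC (hD : IsVerma D) (c a b : ℂ) (v w z : F) :
    c • (tens (cmul w22 w21) v + a • tens (cmul w11 w22 + cmul w21 w12) w
      - b • tens (cmul w11 w12) z) = U D (-(c * b) • z) ((c * a) • w) (c • v) 0 0 0 0 := by
  rw [tens_add, (tens_W hD _ _).2.1, (tens_W hD _ _).1, (tens_W hD _ _).1, (tens_W hD _ _).2.2.2,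
    (tens_w hD _).2.2.2, (tens_w hD _).2.2.1, (tens_w hD _).2.2.1, (tens_w hD _).2.1]
  simp only [U, map_smul, map_zero]
  module

theorem formD (hD : IsVerma D) (c a b : ℂ) (v w z : F) :
    c • (tens (cmul w22 w12) v - a • tens (cmul w22 w11 + cmul w21 w12) w
      - b • tens (cmul w11 w21) z) = U D 0 0 0 (-(c * b) • z) (-(c * a) • w) (c • v) 0 := by
  rw [tens_add, (tens_W hD _ _).2.1, (tens_W hD _ _).1, (tens_W hD _ _).2.1, (tens_W hD _ _).2.2.2,
    (tens_w hD _).2.2.2, (tens_w hD _).2.2.1, (tens_w hD _).2.2.1, (tens_w hD _).1]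
  simp only [U, map_smul, map_zero]
  module

end Final
end Sing2

theorem degree_two_singular_vectors
    (F : Type*) [AddCommGroup F] [Module ℂ F] [FiniteDimensional ℂ F]
    (D : VermaData F) (hD : IsVerma D) (hirr : IsIrred D)
    (wa wb wt wc : ℂ) (vμ : F) (hμ : IsHWvec D (wa, wb, wt, wc) vμ)
    (u : VInd F) :
    (IsSingular D u ∧ HomogDeg u 2 ∧ IsHW D u) ↔
      ∃ c : ℂ, c ≠ 0 ∧
        ((∃ n : ℕ, wa = 0 ∧ wb = n ∧ wt = 1 - (n : ℂ) / 2 ∧ wc = -1 - (n : ℂ) / 2 ∧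
            u = c • tens (cmul w11 w21) vμ) ∨
         (∃ m : ℕ, wa = m ∧ wb = 0 ∧ wt = 1 - (m : ℂ) / 2 ∧ wc = 1 + (m : ℂ) / 2 ∧
            u = c • tens (cmul w11 w12) vμ) ∨
         (∃ m : ℕ, 1 < m ∧ wa = m ∧ wb = 0 ∧ wt = 2 + (m : ℂ) / 2 ∧ wc = -(m : ℂ) / 2 ∧
            u = c • (tens (cmul w22 w21) vμ
                  + (m : ℂ)⁻¹ • tens (cmul w11 w22 + cmul w21 w12) (fxF D vμ)
                  - ((m : ℂ) * ((m : ℂ) - 1))⁻¹ • tens (cmul w11 w12) (fxF D (fxF D vμ)))) ∨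
         (∃ n : ℕ, 1 < n ∧ wa = 0 ∧ wb = n ∧ wt = 2 + (n : ℂ) / 2 ∧ wc = (n : ℂ) / 2 ∧
            u = c • (tens (cmul w22 w12) vμ
                  - (n : ℂ)⁻¹ • tens (cmul w22 w11 + cmul w21 w12) (fyF D vμ)
                  - ((n : ℂ) * ((n : ℂ) - 1))⁻¹ • tens (cmul w11 w21) (fyF D (fyF D vμ))))) := by
  obtain ⟨ht, hC⟩ := Sing2.scalars hD hirr hμ
  obtain ⟨P, H⟩ := Sing2.sl2_irr hD hirr hμ
  have H' : Sing2.Sl2Pair.HW (Sing2.eyF D) (hyF D) (Sing2.exF D) (hxF D) wb wa vμ :=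
    ⟨H.ne, H.ey0, H.ex0, H.hyv, H.hxv⟩
  rw [Sing2.good_iff hD]
  constructor
  · rintro ⟨h0, h1, hg⟩
    obtain ⟨p1, p2, p3, q1, q2, q3, r, rfl⟩ := Sing2.exists_U hD h1
    simp only [Sing2.formC hD, Sing2.formD hD]
    simp only [Sing2.formA hD, Sing2.formB hD]
    exact Sing2.forward hD P H ht hC p1 p2 p3 q1 q2 q3 r h0 hg
  · rintro ⟨c, hc, h⟩
    rcases h with ⟨n, ha, hb, h1, h2, rfl⟩ | ⟨n, ha, hb, h1, h2, rfl⟩ |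
      ⟨n, hn, ha, hb, h1, h2, rfl⟩ | ⟨n, hn, ha, hb, h1, h2, rfl⟩
    · rw [Sing2.formA hD]
      refine ⟨?_, Sing2.homog_U hD _ _ _ _ _ _ _, ?_⟩
      · intro h
        exact (smul_ne_zero hc H.ne) (Sing2.U_zero hD h).2.2.2.1
      · refine Sing2.revY hD P H ht hC ha _ _ _ ?_
        simp only [map_smul, map_zero, H.ey0, H.hyv, smul_zero, neg_zero, add_zero]
        refine ⟨trivial, trivial, trivial, ?_, ?_, trivial, trivial⟩
        · rw [h1, hb]; module
        · rw [h2, hb]; module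
    · rw [Sing2.formB hD]
      refine ⟨?_, Sing2.homog_U hD _ _ _ _ _ _ _, ?_⟩
      · intro h
        exact (smul_ne_zero hc H.ne) (Sing2.U_zero hD h).1
      · refine Sing2.revX hD P H ht hC hb _ _ _ ?_
        simp only [map_smul, map_zero, H.ex0, H.hxv, smul_zero, neg_zero, add_zero]
        refine ⟨trivial, trivial, trivial, ?_, ?_, trivial, trivial⟩
        · rw [h1, ha]; module
        · rw [h2, ha]; module
    · refine ⟨?_, ?_, ?_⟩
      · intro h
        rw [Sing2.formC hD] at h
        exact (smul_ne_zero hc H.ne) (Sing2.U_zero hD h).2.2.1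
      · rw [Sing2.formC hD]
        exact Sing2.homog_U hD _ _ _ _ _ _ _
      · apply Sing2.Good.smul
        have e := Sing2.formC hD 1 (n : ℂ)⁻¹ ((n : ℂ) * ((n : ℂ) - 1))⁻¹ vμ (fxF D vμ)
          (fxF D (fxF D vμ))
        rw [one_smul] at e
        rw [e]
        refine Sing2.revX hD P H ht hC hb _ _ _ ?_
        exact P.branch_conv H n hn ha wt (-wc) h1 (by rw [h2]; ring) _ _ _ (one_smul _ _)
          (by rw [one_mul, neg_smul]) (by rw [one_mul])
    · refine ⟨?_, ?_, ?_⟩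
      · intro h
        rw [Sing2.formD hD] at h
        exact (smul_ne_zero hc H.ne) (Sing2.U_zero hD h).2.2.2.2.2.1
      · rw [Sing2.formD hD]
        exact Sing2.homog_U hD _ _ _ _ _ _ _
      · apply Sing2.Good.smul
        have e := Sing2.formD hD 1 (n : ℂ)⁻¹ ((n : ℂ) * ((n : ℂ) - 1))⁻¹ vμ (fyF D vμ)
          (fyF D (fyF D vμ))
        rw [one_smul] at e
        rw [e]
        refine Sing2.revY hD P H ht hC ha _ _ _ ?_
        exact P.swap.branch_conv H' n hn hb wt wc h1 h2 _ _ _ (one_smul _ _)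
          (by rw [one_mul]) (by rw [one_mul])
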